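/- arXiv:1612.01164 — 6 statements merged into one kernel-verified Lean document; each statement's English description precedes it below -/
import Mathlib

section
/- Let a = Σ_{i∈ℤ} a_i T^i be a series lying in 𝓔 (so v_p(a_i) is bounded below and v_p(a_i) → ∞ as i → −∞). Then a lies in 𝓔^r if and only if there exists a real number d > 0 such that v_n(a) ≥ −p^{rn}·d for every integer n ≥ 0. -/
open Filter

/-- The additive `p`-adic valuation attached to the norm of `K`,
normalized so that `vp p p = 1` when `‖(p : K)‖ = p⁻¹`.  (Junk value `0` at `0`;
all statements guard by `≠ 0`.) -/
noncomputable def vp (p : ℕ) {K : Type*} [NormedField K] (x : K) : ℝ :=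
  -Real.logb p ‖x‖

/-- The two-sided series `Σ aᵢ Tⁱ` lies in `𝓔`: the valuations of the
coefficients are bounded below and tend to `∞` as `i → -∞`. -/
def MemE (p : ℕ) {K : Type*} [NormedField K] (a : ℤ → K) : Prop :=
  (∃ B : ℝ, ∀ i : ℤ, a i ≠ 0 → B ≤ vp p (a i)) ∧
  (∀ M : ℝ, ∃ N : ℤ, ∀ i : ℤ, i ≤ N → a i ≠ 0 → M ≤ vp p (a i))

/-- The series lies in `𝓔^r`: it lies in `𝓔` and there is a constant `c` with
`v_p(aᵢ) - log_p(-i)/r ≥ c` for every `i < 0` (with `aᵢ ≠ 0`). -/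
def MemEr (p : ℕ) (r : ℝ) {K : Type*} [NormedField K] (a : ℤ → K) : Prop :=
  MemE p a ∧
  ∃ c : ℝ, ∀ i : ℤ, i < 0 → a i ≠ 0 →
    c ≤ vp p (a i) - Real.logb p (-(i : ℝ)) / r

/-- Let `a ∈ 𝓔`.  Then `a ∈ 𝓔^r` if and only if there is a real
`d > 0` such that the naive partial valuation satisfies `vₙ(a) ≥ -p^{rn}·d` for
every `n ≥ 0`; here `vₙ(a) = min { i : v_p(aᵢ) ≤ n }`, so the inequality
`vₙ(a) ≥ X` is rendered as: every `i` with `aᵢ ≠ 0` and `v_p(aᵢ) ≤ n`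
satisfies `i ≥ X`. -/
theorem statement0 {K : Type*} [NontriviallyNormedField K] [CompleteSpace K]
    [IsUltrametricDist K] {p : ℕ} (hp : p.Prime)
    (hpnorm : ‖(p : K)‖ = (p : ℝ)⁻¹)
    {r : ℝ} (hr : 0 < r) (a : ℤ → K) (ha : MemE p a) :
    MemEr p r a ↔
      ∃ d : ℝ, 0 < d ∧ ∀ n : ℕ, ∀ i : ℤ, a i ≠ 0 → vp p (a i) ≤ (n : ℝ) →
        -((p : ℝ) ^ (r * (n : ℝ)) * d) ≤ (i : ℝ) := by
  have hp1 : (1 : ℝ) < p := by exact_mod_cast hp.one_lt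
  have hp0 : (0 : ℝ) < p := by linarith
  constructor
  · rintro ⟨-, c, hc⟩
    refine ⟨(p : ℝ) ^ (-(r * c)), Real.rpow_pos_of_pos hp0 _, ?_⟩
    intro n i hi hn
    rw [← Real.rpow_add hp0]
    have hpos := Real.rpow_pos_of_pos hp0 (r * n + -(r * c))
    rcases lt_or_ge i 0 with h | h
    · have h1 := hc i h hi
      have hi0 : (0 : ℝ) < -(i : ℝ) := by
        have : (i : ℝ) < 0 := by exact_mod_cast h
        linarith
      have h2 : Real.logb p (-(i : ℝ)) / r ≤ n - c := by linarith
      rw [div_le_iff₀ hr] at h2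
      have h3 : Real.logb p (-(i : ℝ)) ≤ r * n + -(r * c) := by linarith
      rw [Real.logb_le_iff_le_rpow hp1 hi0] at h3
      linarith
    · have : (0 : ℝ) ≤ i := by exact_mod_cast h
      linarith
  · rintro ⟨d, hd, h⟩
    refine ⟨ha, ?_⟩
    obtain ⟨⟨B, hB⟩, -⟩ := ha
    refine ⟨-(1 + |B| + Real.logb p d / r), ?_⟩
    intro i hi hai
    have hi0 : (0 : ℝ) < -(i : ℝ) := by
      have : (i : ℝ) < 0 := by exact_mod_cast hi
      linarith
    have h1 := h ⌈vp p (a i)⌉₊ i hai (Nat.le_ceil _)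
    have hn : (⌈vp p (a i)⌉₊ : ℝ) ≤ vp p (a i) + 1 + |B| := by
      have hb := hB i hai
      have hb2 := neg_abs_le B
      rcases le_or_gt 0 (vp p (a i)) with h0 | h0
      · have := Nat.ceil_lt_add_one h0
        have := abs_nonneg B
        linarith
      · rw [Nat.ceil_eq_zero.2 h0.le]
        push_cast
        linarith
    generalize ⌈vp p (a i)⌉₊ = n at h1 hn
    have hpos := Real.rpow_pos_of_pos hp0 (r * n)
    have h2 : Real.logb p (-(i : ℝ)) ≤ Real.logb p ((p : ℝ) ^ (r * (n : ℝ)) * d) :=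
      Real.logb_le_logb_of_le hp1 hi0 (by linarith)
    rw [Real.logb_mul hpos.ne' hd.ne', Real.logb_rpow hp0 hp1.ne'] at h2
    have h3 : Real.logb p (-(i : ℝ)) / r ≤ n + Real.logb p d / r := by
      rw [div_le_iff₀ hr, add_mul, div_mul_cancel₀ _ hr.ne']
      linarith
    linarith
end

section
/- If a and b both lie in 𝓔^r, then their convolution product c, defined by c_n = Σ_{i∈ℤ} a_i·b_{n−i} (each such sum converges in K), also lies in 𝓔^r. In particular 𝓔^r is closed under the multiplication of 𝓔. -/
open Filter

theorem exists_term_le {K : Type*} [NormedField K] [IsUltrametricDist K] {f : ℤ → K} {x : K}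
    (h : HasSum f x) (hx : x ≠ 0) : ∃ i, ‖x‖ ≤ ‖f i‖ := by
  by_contra! hcon
  have hpos : 0 < ‖x‖ := norm_pos_iff.mpr hx
  have hS : ∀ s : Finset ℤ, ‖∑ i ∈ s, f i‖ < ‖x‖ := by
    intro s
    induction s using Finset.induction_on with
    | empty => simpa using hpos
    | insert a s ha ih =>
      rw [Finset.sum_insert ha]
      exact lt_of_le_of_lt (IsUltrametricDist.norm_add_le_max _ _) (max_lt (hcon a) ih)
  obtain ⟨s, hs⟩ := ((Metric.tendsto_nhds.mp h) ‖x‖ hpos).exists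
  rw [dist_comm, dist_eq_norm] at hs
  have h1 := IsUltrametricDist.norm_add_le_max (x - ∑ i ∈ s, f i) (∑ i ∈ s, f i)
  rw [sub_add_cancel] at h1
  exact absurd (lt_of_le_of_lt h1 (max_lt hs (hS s))) (lt_irrefl _)

theorem exists_vp_le {K : Type*} [NormedField K] [IsUltrametricDist K] {p : ℕ} (hp : p.Prime)
    {a b : ℤ → K} {n : ℤ} {x : K}
    (h : HasSum (fun i : ℤ => a i * b (n - i)) x) (hx : x ≠ 0) :
    ∃ i, a i ≠ 0 ∧ b (n - i) ≠ 0 ∧ vp p (a i) + vp p (b (n - i)) ≤ vp p x := by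
  obtain ⟨i, hi⟩ := exists_term_le h hx
  have hpos : 0 < ‖x‖ := norm_pos_iff.mpr hx
  have hne : a i * b (n - i) ≠ 0 := norm_pos_iff.mp (hpos.trans_le hi)
  have h1 := left_ne_zero_of_mul hne
  have h2 := right_ne_zero_of_mul hne
  refine ⟨i, h1, h2, ?_⟩
  have hp1 : (1 : ℝ) < p := by exact_mod_cast hp.one_lt
  have h3 := Real.logb_le_logb_of_le hp1 hpos hi
  rw [norm_mul, Real.logb_mul (norm_ne_zero_iff.mpr h1) (norm_ne_zero_iff.mpr h2)] at h3
  unfold vp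
  linarith

theorem log_half_le {p : ℕ} (hp : p.Prime) {r : ℝ} (hr : 0 < r) {n j : ℤ} (hn : n < 0)
    (hj : 2 * j ≤ n) :
    Real.logb p (-(n : ℝ)) / r - Real.logb p 2 / r ≤ Real.logb p (-(j : ℝ)) / r := by
  have hp1 : (1 : ℝ) < p := by exact_mod_cast hp.one_lt
  have hn' : (n : ℝ) < 0 := by exact_mod_cast hn
  have hj' : 2 * (j : ℝ) ≤ n := by exact_mod_cast hj
  rw [← sub_div, ← Real.logb_div (by linarith) (by norm_num)]
  exact div_le_div_of_nonneg_right
    (Real.logb_le_logb_of_le hp1 (by linarith) (by linarith)) hr.le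

/-- If `a, b ∈ 𝓔^r` and `c` is their convolution product
(`cₙ = Σᵢ aᵢ·b_{n-i}`, each sum converging in `K`), then `c ∈ 𝓔^r`.
In particular `𝓔^r` is closed under the multiplication of `𝓔`. -/
theorem statement1 {K : Type*} [NontriviallyNormedField K] [CompleteSpace K]
    [IsUltrametricDist K] {p : ℕ} (hp : p.Prime)
    (hpnorm : ‖(p : K)‖ = (p : ℝ)⁻¹)
    {r : ℝ} (hr : 0 < r) (a b c : ℤ → K)
    (ha : MemEr p r a) (hb : MemEr p r b)
    (hc : ∀ n : ℤ, HasSum (fun i : ℤ => a i * b (n - i)) (c n)) :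
    MemEr p r c := by
  obtain ⟨⟨⟨A, hA⟩, hA'⟩, ca, hca⟩ := ha
  obtain ⟨⟨⟨B, hB⟩, hB'⟩, cb, hcb⟩ := hb
  refine ⟨⟨⟨A + B, ?_⟩, ?_⟩, min (ca + B) (cb + A) - Real.logb p 2 / r, ?_⟩
  · intro n hn
    obtain ⟨i, h1, h2, h3⟩ := exists_vp_le hp (hc n) hn
    linarith [hA _ h1, hB _ h2]
  · intro M
    obtain ⟨N1, hN1⟩ := hA' (M - B)
    obtain ⟨N2, hN2⟩ := hB' (M - A)
    refine ⟨N1 + N2, ?_⟩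
    intro n hnN hn
    obtain ⟨i, h1, h2, h3⟩ := exists_vp_le hp (hc n) hn
    rcases le_total i N1 with h | h
    · linarith [hN1 i h h1, hB _ h2]
    · linarith [hN2 (n - i) (by lia) h2, hA _ h1]
  · intro n hn0 hn
    obtain ⟨i, h1, h2, h3⟩ := exists_vp_le hp (hc n) hn
    have m1 := min_le_left (ca + B) (cb + A)
    have m2 := min_le_right (ca + B) (cb + A)
    rcases le_total (2 * i) n with h | h
    · linarith [hca i (by lia) h1, hB _ h2, log_half_le hp hr hn0 h]
    · have h' : 2 * (n - i) ≤ n := by lia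
      linarith [hcb (n - i) (by lia) h2, hA _ h1, log_half_le hp hr hn0 h']
end

section
/- Let a lie in 𝓔^r and let b lie in 𝓔, and suppose that the convolution product of a and b is the multiplicative identity, i.e. Σ_{i∈ℤ} a_i·b_{−i} = 1 and Σ_{i∈ℤ} a_i·b_{n−i} = 0 for every n ≠ 0. Then b lies in 𝓔^r. In particular every nonzero element of 𝓔^r has its inverse (taken in the field 𝓔) in 𝓔^r, so 𝓔^r is a subfield of 𝓔. -/
open Filter

section aux
open Topology

lemma aux_argmax (f : ℕ → ℝ) (hf : Tendsto f atTop (𝓝 0)) (n0 : ℕ) (h0 : 0 < f n0) :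
    ∃ m, 0 < f m ∧ (∀ n, f n ≤ f m) ∧ ∀ n, m < n → f n < f m := by
  have fin : ∀ c : ℝ, 0 < c → {n | c ≤ f n}.Finite := by
    intro c hc
    obtain ⟨N, hN⟩ := eventually_atTop.1 (hf.eventually (gt_mem_nhds hc))
    refine (Set.finite_lt_nat N).subset ?_
    intro n hn
    by_contra h
    have := hN n (not_lt.1 h)
    simp only [Set.mem_ofPred_eq] at hn
    linarith
  obtain ⟨m1, hm1, hmax⟩ := Set.exists_max_image _ f (fin _ h0) ⟨n0, le_refl (f n0)⟩
  simp only [Set.mem_ofPred_eq] at hm1 hmax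
  have hpos : 0 < f m1 := lt_of_lt_of_le h0 hm1
  have hall : ∀ n, f n ≤ f m1 := by
    intro n
    rcases le_total (f n0) (f n) with h | h
    · exact hmax n h
    · exact h.trans hm1
  obtain ⟨m, hm, hmm⟩ := Set.exists_max_image _ id (fin _ hpos) ⟨m1, le_refl (f m1)⟩
  simp only [Set.mem_ofPred_eq, id] at hm hmm
  refine ⟨m, by linarith, fun n => (hall n).trans hm, fun n hn => ?_⟩
  by_contra h
  have := hmm n (by linarith)
  omega

variable {K : Type*} [NormedField K] [IsUltrametricDist K]

lemma aux_sum_lt {f : ℤ → K} {s : K} (hs : HasSum f s) {c : ℝ} (hc : 0 < c)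
    (h : ∀ i, ‖f i‖ < c) : ‖s‖ < c := by
  have hcl : IsClosed (Metric.ball (0 : K) c) := IsUltrametricDist.isClosed_ball _ _
  have : s ∈ Metric.ball (0 : K) c := by
    refine hcl.mem_of_tendsto hs (Eventually.of_forall fun t => ?_)
    rw [mem_ball_zero_iff]
    induction t using Finset.induction_on with
    | empty => simpa using hc
    | insert a t hat ih =>
      rw [Finset.sum_insert hat]
      exact (IsUltrametricDist.norm_add_le_max _ _).trans_lt (max_lt (h a) ih)
  simpa using this

lemma aux_dom {f : ℤ → K} {s : K} (hs : HasSum f s) (i0 : ℤ) (h0 : 0 < ‖f i0‖)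
    (h : ∀ i, i ≠ i0 → ‖f i‖ < ‖f i0‖) : ‖f i0‖ ≤ ‖s‖ := by
  have h1 := hs.update i0 0
  have h2 := aux_sum_lt h1 h0 (by
    intro i
    by_cases hi : i = i0
    · subst hi; simpa using h0
    · simpa [Function.update_of_ne hi] using h i hi)
  by_contra hlt
  push Not at hlt
  have h3 : ‖f i0‖ ≤ max ‖s‖ ‖(0 - f i0 + s)‖ := by
    have := IsUltrametricDist.norm_add_le_max s (-(0 - f i0 + s))
    rw [norm_neg] at this
    have e : s + -(0 - f i0 + s) = f i0 := by ring
    rwa [e] at this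
  rcases le_max_iff.1 h3 with h | h <;> linarith

lemma aux_wmax (a : ℤ → K) (A : ℝ) (hA : ∀ i, ‖a i‖ ≤ A) (t : ℝ) (ht0 : 0 < t) (ht1 : t < 1)
    (N : ℕ) (i0 : ℤ) (hi0 : -(N:ℤ) ≤ i0) (hi0' : i0 ≤ N) (hpos : a i0 ≠ 0) :
    ∃ m : ℤ, -(N:ℤ) ≤ m ∧ ‖a i0‖ * t ^ (2*N) ≤ ‖a m‖ ∧ 
      (∀ i, -(N:ℤ) ≤ i → ‖a i‖ * t ^ i ≤ ‖a m‖ * t ^ m) ∧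
      (∀ i, m < i → ‖a i‖ * t ^ i < ‖a m‖ * t ^ m) := by
  have hlim : Tendsto (fun k : ℕ => ‖a (k - N)‖ * t ^ k) atTop (𝓝 0) := by
    have h1 : Tendsto (fun k : ℕ => A * t ^ k) atTop (𝓝 0) := by
      simpa using (tendsto_pow_atTop_nhds_zero_of_lt_one ht0.le ht1).const_mul A
    refine squeeze_zero (fun k => by positivity) (fun k => ?_) h1
    exact mul_le_mul_of_nonneg_right (hA _) (by positivity)
  have e : ∀ i : ℤ, -(N:ℤ) ≤ i → ∃ k : ℕ, i = k - N := by
    intro i hi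
    exact ⟨(i + N).toNat, by omega⟩
  have conv : ∀ k : ℕ, ‖a (k - N)‖ * t ^ ((k:ℤ) - N) = (‖a (k - N)‖ * t ^ k) * (t ^ N)⁻¹ := by
    intro k
    rw [zpow_sub₀ ht0.ne', zpow_natCast, zpow_natCast]
    ring
  have htN : 0 < (t ^ N)⁻¹ := by positivity
  obtain ⟨k0, rfl⟩ := e i0 hi0
  obtain ⟨m, hm, hle, hlt⟩ := aux_argmax _ hlim k0 (by
    have := norm_pos_iff.2 hpos
    positivity)
  refine ⟨m - N, by omega, ?_, ?_, ?_⟩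
  · have h1 := hle k0
    have h2 : k0 ≤ 2 * N := by omega
    have h3 : t ^ (2*N) ≤ t ^ k0 := pow_le_pow_of_le_one ht0.le ht1.le h2
    have h4 : t ^ m ≤ 1 := pow_le_one₀ ht0.le ht1.le
    calc _ ≤ ‖a (k0 - N)‖ * t ^ k0 := by gcongr
      _ ≤ _ := h1
      _ ≤ ‖a (m - N)‖ * 1 := by gcongr
      _ = _ := mul_one _
  · intro i hi
    obtain ⟨k, rfl⟩ := e i hi
    rw [conv, conv]
    exact mul_le_mul_of_nonneg_right (hle k) htN.le
  · intro i hi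
    obtain ⟨k, rfl⟩ := e i (by omega)
    rw [conv, conv]
    exact mul_lt_mul_of_pos_right (hlt k (by omega)) htN

lemma aux_mult (a b : ℤ → K) (A B : ℝ) (hA : ∀ i, ‖a i‖ ≤ A) (hB : ∀ i, ‖b i‖ ≤ B)
    (ha : ∀ e : ℝ, 0 < e → ∃ N : ℤ, ∀ i ≤ N, ‖a i‖ < e)
    (hb : ∀ e : ℝ, 0 < e → ∃ N : ℤ, ∀ i ≤ N, ‖b i‖ < e)
    (s : ℤ → K) (hs1 : ∀ n, ‖s n‖ ≤ 1)
    (hs : ∀ n, HasSum (fun i => a i * b (n - i)) (s n)) (i0 j0 : ℤ) :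
    ‖a i0‖ * ‖b j0‖ ≤ 1 := by
  by_contra hP
  push Not at hP
  have ha0 : a i0 ≠ 0 := by rintro h; simp [h] at hP; linarith
  have hb0 : b j0 ≠ 0 := by rintro h; simp [h] at hP; linarith
  have hApos : 0 < A := (norm_pos_iff.2 ha0).trans_le (hA _)
  have hBpos : 0 < B := (norm_pos_iff.2 hb0).trans_le (hB _)
  obtain ⟨Na, hNa⟩ := ha B⁻¹ (by positivity)
  obtain ⟨Nb, hNb⟩ := hb A⁻¹ (by positivity)
  obtain ⟨N, h1, h2, h3, h4⟩ : ∃ N : ℕ, i0.natAbs ≤ N ∧ j0.natAbs ≤ N ∧ Na.natAbs ≤ N ∧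
      Nb.natAbs ≤ N := ⟨i0.natAbs + j0.natAbs + Na.natAbs + Nb.natAbs, by omega, by omega,
        by omega, by omega⟩
  obtain ⟨t, ht0, ht1, htP⟩ : ∃ t : ℝ, 0 < t ∧ t < 1 ∧
      1 < (‖a i0‖ * t ^ (2*N)) * (‖b j0‖ * t ^ (2*N)) := by
    have hc : ContinuousAt (fun t : ℝ => (‖a i0‖ * t ^ (2*N)) * (‖b j0‖ * t ^ (2*N))) 1 := by
      fun_prop
    have h5 : ∀ᶠ t in 𝓝[<] (1:ℝ), 1 < (‖a i0‖ * t ^ (2*N)) * (‖b j0‖ * t ^ (2*N)) :=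
      (hc.tendsto.mono_left nhdsWithin_le_nhds).eventually (lt_mem_nhds (by simpa using hP))
    have h6 : ∀ᶠ t in 𝓝[<] (1:ℝ), 0 < t :=
      (lt_mem_nhds (by norm_num : (0:ℝ) < 1)).filter_mono nhdsWithin_le_nhds
    obtain ⟨t, ha, hb, hc⟩ := (h5.and (h6.and self_mem_nhdsWithin)).exists
    exact ⟨t, hb, hc, ha⟩
  obtain ⟨m, hm, hma, hmle, hmlt⟩ := aux_wmax a A hA t ht0 ht1 N i0 (by omega) (by omega) ha0
  obtain ⟨l, hl, hlb, hlle, hllt⟩ := aux_wmax b B hB t ht0 ht1 N j0 (by omega) (by omega) hb0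
  have hbig : 1 < ‖a m‖ * ‖b l‖ := htP.trans_le (by gcongr)
  have hsum := hs (m + l)
  have hterm : a m * b (m + l - m) = a m * b l := by congr 2; ring
  have := aux_dom hsum m (by simp only [hterm, norm_mul]; linarith) (by
    intro i hi
    simp only [hterm, norm_mul]
    obtain ⟨j, hj⟩ : ∃ j, j = m + l - i := ⟨_, rfl⟩
    rw [← hj]
    by_cases hiN : i < -(N:ℤ)
    · have h7 := hNa i (by omega)
      have : ‖a i‖ * ‖b j‖ ≤ B⁻¹ * B := by
        gcongr
        exact hB j
      rw [inv_mul_cancel₀ hBpos.ne'] at this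
      linarith
    by_cases hjN : j < -(N:ℤ)
    · have h7 := hNb j (by omega)
      have : ‖a i‖ * ‖b j‖ ≤ A * A⁻¹ := by
        gcongr
        exact hA i
      rw [mul_inv_cancel₀ hApos.ne'] at this
      linarith
    have hmpos : 0 < ‖a m‖ * t ^ m := by
      have : 0 < ‖a m‖ := by
        rcases (norm_nonneg (a m)).eq_or_lt with h | h
        · rw [← h] at hbig; simp at hbig; linarith
        · exact h
      positivity
    have hlpos : 0 < ‖b l‖ * t ^ l := by
      have : 0 < ‖b l‖ := by
        rcases (norm_nonneg (b l)).eq_or_lt with h | h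
        · rw [← h] at hbig; simp at hbig; linarith
        · exact h
      positivity
    have key : (‖a i‖ * t ^ i) * (‖b j‖ * t ^ j) < (‖a m‖ * t ^ m) * (‖b l‖ * t ^ l) := by
      rcases lt_or_gt_of_ne hi with h | h
      · have hlj : l < j := by omega
        exact mul_lt_mul' (hmle i (by omega)) (hllt j hlj) (by positivity) hmpos
      · calc _ ≤ (‖a i‖ * t ^ i) * (‖b l‖ * t ^ l) :=
                mul_le_mul_of_nonneg_left (hlle j (by omega)) (by positivity)
            _ < _ := mul_lt_mul_of_pos_right (hmlt i h) hlpos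
    have e1 : t ^ i * t ^ j = t ^ m * t ^ l := by
      rw [← zpow_add₀ ht0.ne', ← zpow_add₀ ht0.ne']
      congr 1
      omega
    have e2 : (‖a i‖ * ‖b j‖) * (t ^ m * t ^ l) < (‖a m‖ * ‖b l‖) * (t ^ m * t ^ l) := by
      calc _ = (‖a i‖ * t ^ i) * (‖b j‖ * t ^ j) := by rw [← e1]; ring
        _ < _ := key
        _ = _ := by ring
    exact lt_of_mul_lt_mul_right e2 (by positivity))
  simp only [hterm, norm_mul] at this
  have := hs1 (m + l)
  linarith

lemma aux_shift (x : ℤ → K) (B C s : ℝ) (hs : 0 < s) (hB : ∀ i, ‖x i‖ ≤ B)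
    (hC : ∀ i : ℤ, i < 0 → ‖x i‖ * (-(i:ℝ)) ^ s ≤ C) (m : ℤ) :
    ∃ C' : ℝ, ∀ i : ℤ, i < 0 → ‖x (m + i)‖ * (-(i:ℝ)) ^ s ≤ C' := by
  refine ⟨max B C * (1 + |(m:ℝ)|) ^ s, fun i hi => ?_⟩
  have hi' : (i:ℝ) ≤ -1 := by exact_mod_cast (by omega : i ≤ -1)
  have hB0 : 0 ≤ B := (norm_nonneg _).trans (hB 0)
  have hm0 := abs_nonneg (m:ℝ)
  have hm1 := le_abs_self (m:ℝ)
  by_cases h : m + i < 0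
  · have h' : (m:ℝ) + i ≤ -1 := by exact_mod_cast (by omega : m + i ≤ -1)
    have h1 : -(i:ℝ) ≤ (-((m + i : ℤ):ℝ)) * (1 + |(m:ℝ)|) := by
      push_cast
      nlinarith
    have h2 : (-(i:ℝ)) ^ s ≤ (-((m + i : ℤ):ℝ)) ^ s * (1 + |(m:ℝ)|) ^ s := by
      rw [← Real.mul_rpow (by push_cast; linarith) (by linarith)]
      exact Real.rpow_le_rpow (by linarith) h1 hs.le
    calc _ ≤ ‖x (m + i)‖ * ((-((m + i : ℤ):ℝ)) ^ s * (1 + |(m:ℝ)|) ^ s) := by gcongr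
      _ = (‖x (m + i)‖ * (-((m + i : ℤ):ℝ)) ^ s) * (1 + |(m:ℝ)|) ^ s := by ring
      _ ≤ _ := mul_le_mul_of_nonneg_right ((hC _ h).trans (le_max_right _ _)) (by positivity)
  · have h' : 0 ≤ (m:ℝ) + i := by exact_mod_cast (by omega : 0 ≤ m + i)
    have h2 : (-(i:ℝ)) ^ s ≤ (1 + |(m:ℝ)|) ^ s :=
      Real.rpow_le_rpow (by linarith) (by linarith) hs.le
    exact mul_le_mul ((hB _).trans (le_max_left _ _)) h2
      (Real.rpow_nonneg (by linarith) _) (hB0.trans (le_max_left _ _))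

lemma aux_tendsto (x : ℤ → K) (hx : ∀ e : ℝ, 0 < e → ∃ N : ℤ, ∀ i ≤ N, ‖x i‖ < e) (n : ℤ) :
    Tendsto (fun k : ℕ => ‖x (n - k)‖) atTop (𝓝 0) := by
  rw [Metric.tendsto_atTop]
  intro e he
  obtain ⟨N, hN⟩ := hx e he
  refine ⟨(n - N).toNat, fun k hk => ?_⟩
  simpa using hN (n - k) (by omega)

lemma aux_main (a b : ℤ → K) (B C s : ℝ) (hs : 0 < s) (hB : ∀ i, ‖b i‖ ≤ B)
    (ha : ∀ e : ℝ, 0 < e → ∃ N : ℤ, ∀ i ≤ N, ‖a i‖ < e)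
    (hb : ∀ e : ℝ, 0 < e → ∃ N : ℤ, ∀ i ≤ N, ‖b i‖ < e)
    (hC : ∀ i : ℤ, i < 0 → ‖a i‖ * (-(i:ℝ)) ^ s ≤ C)
    (ha0 : 0 < ‖a 0‖) (hle : ∀ i, ‖a i‖ ≤ ‖a 0‖) (hlt : ∀ i < 0, ‖a i‖ < ‖a 0‖)
    (hz : ∀ n < 0, HasSum (fun i => a i * b (n - i)) 0) :
    ∃ D : ℝ, ∀ i : ℤ, i < 0 → ‖b i‖ * (-(i:ℝ)) ^ s ≤ D := by
  obtain ⟨ρ, hρ0, hρ1, hρ⟩ : ∃ ρ : ℝ, 0 ≤ ρ ∧ ρ < 1 ∧ ∀ i < 0, ‖a i‖ ≤ ρ * ‖a 0‖ := by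
    by_cases h : ∃ i < 0, 0 < ‖a i‖
    · obtain ⟨i, hi, hi0⟩ := h
      obtain ⟨m, hm, hmax, -⟩ := aux_argmax _ (aux_tendsto a ha (-1)) (-1 - i).toNat (by
        convert hi0 using 3; omega)
      refine ⟨‖a (-1 - m)‖ / ‖a 0‖, by positivity, (div_lt_one ha0).2 (hlt _ (by omega)), ?_⟩
      intro i hi
      rw [div_mul_cancel₀ _ ha0.ne']
      convert hmax (-1 - i).toNat using 3
      omega
    · push Not at h
      exact ⟨0, le_rfl, one_pos, fun i hi => by simpa using h i hi⟩
  obtain ⟨ε, hε0, hε1, hε⟩ : ∃ ε : ℝ, 0 < ε ∧ ε < 1 ∧ ρ ≤ (1 - ε) ^ s := by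
    have hc : ContinuousAt (fun e : ℝ => (1 - e) ^ s) 0 := by
      apply ContinuousAt.rpow_const
      · fun_prop
      · right; exact hs.le
    have h5 : ∀ᶠ t in 𝓝[>] (0:ℝ), ρ < (1 - t) ^ s :=
      (hc.tendsto.mono_left nhdsWithin_le_nhds).eventually (lt_mem_nhds (by simpa using hρ1))
    have h6 : ∀ᶠ t in 𝓝[>] (0:ℝ), t < 1 :=
      (gt_mem_nhds (by norm_num : (0:ℝ) < 1)).filter_mono nhdsWithin_le_nhds
    obtain ⟨t, ha, hb, hc⟩ := (h5.and (h6.and self_mem_nhdsWithin)).exists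
    exact ⟨t, hc, hb, ha.le⟩
  have hB0 : 0 ≤ B := (norm_nonneg _).trans (hB 0)
  have hC0 : 0 ≤ C := by
    refine le_trans ?_ (hC (-1) (by norm_num))
    norm_num
  have hεs : 0 < ε ^ s := Real.rpow_pos_of_pos hε0 _
  set D : ℝ := C * B / (ε ^ s * ‖a 0‖) with hD
  have hD0 : 0 ≤ D := by positivity
  have main : ∀ N : ℕ, 1 ≤ N → ∀ j : ℤ, j ≤ -(N:ℤ) → ‖b j‖ * (N:ℝ) ^ s ≤ D := by
    intro N
    induction N using Nat.strong_induction_on with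
    | _ N ih =>
    intro hN j1 hj1
    rcases (norm_nonneg (b j1)).eq_or_lt with h0 | h0
    · rw [← h0]; simpa using hD0
    obtain ⟨q, hq0, hqle, hqlt⟩ := aux_argmax _ (aux_tendsto b hb (-(N:ℤ))) (-(N:ℤ) - j1).toNat (by
        have e : -(N:ℤ) - ((-(N:ℤ) - j1).toNat : ℤ) = j1 := by omega
        simpa only [e] using h0)
    obtain ⟨j, hj⟩ : ∃ j : ℤ, j = -(N:ℤ) - q := ⟨_, rfl⟩
    rw [← hj] at hq0 hqle hqlt
    have hj1j : ‖b j1‖ ≤ ‖b j‖ := by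
      convert hqle (-(N:ℤ) - j1).toNat using 3; omega
    have hjlt : ∀ i < j, ‖b i‖ < ‖b j‖ := by
      intro i hi
      convert hqlt (-(N:ℤ) - i).toNat (by omega) using 3; omega
    refine (mul_le_mul_of_nonneg_right hj1j (by positivity)).trans ?_
    obtain ⟨i, hi0, hi⟩ : ∃ i, i ≠ 0 ∧ ‖a 0‖ * ‖b j‖ ≤ ‖a i‖ * ‖b (j - i)‖ := by
      by_contra hcon
      push Not at hcon
      have := aux_dom (hz j (by omega)) 0 (by
        simp only [norm_mul, sub_zero]; positivity)
        (by intro i hi; simpa using hcon i hi)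
      simp only [norm_mul, norm_zero, sub_zero] at this
      have : 0 < ‖a 0‖ * ‖b j‖ := by positivity
      linarith
    rcases lt_or_gt_of_ne hi0 with hineg | hipos
    swap
    · exfalso
      have h1 := hjlt (j - i) (by omega)
      have h2 : ‖a i‖ * ‖b (j - i)‖ ≤ ‖a 0‖ * ‖b (j - i)‖ :=
        mul_le_mul_of_nonneg_right (hle i) (norm_nonneg _)
      have h3 := mul_lt_mul_of_pos_left h1 ha0
      linarith
    obtain ⟨k, rfl⟩ : ∃ k : ℕ, i = -(k:ℤ) := ⟨(-i).toNat, by omega⟩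
    have hNpos : (0:ℝ) < N := by exact_mod_cast hN
    have hkpos : (0:ℝ) < k := by
      have : 0 < k := by omega
      exact_mod_cast this
    by_cases hk : (k:ℝ) ≤ ε * N
    · have hkN : k < N := by
        have : (k:ℝ) < N := by nlinarith
        exact_mod_cast this
      have h1 := ih (N - k) (by omega) (by omega) (j - -(k:ℤ)) (by omega)
      rw [Nat.cast_sub hkN.le] at h1
      have h2 : ((1 - ε) * N) ^ s ≤ ((N:ℝ) - k) ^ s :=
        Real.rpow_le_rpow (by nlinarith) (by linarith) hs.le
      rw [Real.mul_rpow (by linarith) hNpos.le] at h2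
      have h3 : ‖b j‖ ≤ ρ * ‖b (j - -(k:ℤ))‖ := by
        have := mul_le_mul_of_nonneg_right (hρ (-(k:ℤ)) hineg) (norm_nonneg (b (j - -(k:ℤ))))
        refine le_of_mul_le_mul_left ?_ ha0
        linarith
      calc ‖b j‖ * (N:ℝ) ^ s ≤ (ρ * ‖b (j - -(k:ℤ))‖) * (N:ℝ) ^ s := by gcongr
        _ ≤ ((1 - ε) ^ s * ‖b (j - -(k:ℤ))‖) * (N:ℝ) ^ s := by gcongr
        _ = ‖b (j - -(k:ℤ))‖ * ((1 - ε) ^ s * (N:ℝ) ^ s) := by ring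
        _ ≤ ‖b (j - -(k:ℤ))‖ * ((N:ℝ) - k) ^ s := by gcongr
        _ ≤ D := h1
    · push Not at hk
      have h1 := hC (-(k:ℤ)) hineg
      push_cast at h1
      rw [neg_neg] at h1
      have h2 : (ε * N) ^ s ≤ (k:ℝ) ^ s := Real.rpow_le_rpow (by positivity) hk.le hs.le
      rw [Real.mul_rpow hε0.le hNpos.le] at h2
      rw [hD, le_div_iff₀ (by positivity)]
      calc ‖b j‖ * (N:ℝ) ^ s * (ε ^ s * ‖a 0‖) = (‖a 0‖ * ‖b j‖) * (ε ^ s * (N:ℝ) ^ s) := by ring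
        _ ≤ (‖a (-(k:ℤ))‖ * ‖b (j - -(k:ℤ))‖) * (k:ℝ) ^ s := by gcongr
        _ = (‖a (-(k:ℤ))‖ * (k:ℝ) ^ s) * ‖b (j - -(k:ℤ))‖ := by ring
        _ ≤ C * B := mul_le_mul h1 (hB _) (norm_nonneg _) hC0
  refine ⟨D, fun i hi => ?_⟩
  have := main (-i).toNat (by omega) i (by omega)
  convert this using 3
  have : (((-i).toNat : ℤ) : ℝ) = ((-i : ℤ) : ℝ) := by congr 1; omega
  push_cast at this
  exact this.symm

end aux

section aux2

variable {K : Type*} [NormedField K]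

lemma aux_vp {p : ℕ} (hp : 1 < (p:ℝ)) (x : K) (hx : x ≠ 0) (B : ℝ) :
    B ≤ vp p x ↔ ‖x‖ ≤ (p:ℝ) ^ (-B) := by
  rw [vp, ← Real.logb_le_iff_le_rpow hp (norm_pos_iff.2 hx)]
  constructor <;> intro h <;> linarith

lemma aux_decay {p : ℕ} (hp : 1 < (p:ℝ)) (x : K) (hx : x ≠ 0) (c r y : ℝ) (hy : 0 < y) :
    c ≤ vp p x - Real.logb p y / r ↔ ‖x‖ * y ^ (1 / r) ≤ (p:ℝ) ^ (-c) := by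
  have hx' := norm_pos_iff.2 hx
  have hy' : 0 < y ^ (1 / r) := Real.rpow_pos_of_pos hy _
  rw [vp, ← Real.logb_le_iff_le_rpow hp (by positivity), Real.logb_mul hx'.ne' hy'.ne',
    Real.logb_rpow_eq_mul_logb_of_pos hy]
  have : Real.logb p y / r = 1 / r * Real.logb p y := by ring
  constructor <;> intro h <;> linarith

lemma aux_memE {p : ℕ} (hp : 1 < (p:ℝ)) (x : ℤ → K) (hx : MemE p x) :
    (∃ A, ∀ i, ‖x i‖ ≤ A) ∧ ∀ e : ℝ, 0 < e → ∃ N : ℤ, ∀ i ≤ N, ‖x i‖ < e := by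
  obtain ⟨⟨B, hB⟩, h2⟩ := hx
  have hp0 : 0 < (p:ℝ) := by linarith
  constructor
  · refine ⟨(p:ℝ) ^ (-B), fun i => ?_⟩
    by_cases h : x i = 0
    · rw [h, norm_zero]; positivity
    · exact (aux_vp hp _ h _).1 (hB i h)
  · intro e he
    obtain ⟨N, hN⟩ := h2 (-Real.logb p (e / 2))
    refine ⟨N, fun i hi => ?_⟩
    by_cases h : x i = 0
    · rw [h, norm_zero]; exact he
    · have := (aux_vp hp _ h _).1 (hN i hi h)
      rw [neg_neg, Real.rpow_logb hp0 hp.ne' (by positivity)] at this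
      linarith

end aux2

/-- If `a ∈ 𝓔^r`, `b ∈ 𝓔` and the convolution product of `a`
and `b` is the multiplicative identity of `𝓔` (constant coefficient `1`, all
other coefficients `0`), then `b ∈ 𝓔^r`.  In particular the inverse (taken in
the field `𝓔`) of a nonzero element of `𝓔^r` again lies in `𝓔^r`, so `𝓔^r`
is a subfield of `𝓔`. -/
theorem statement2 {K : Type*} [NontriviallyNormedField K] [CompleteSpace K]
    [IsUltrametricDist K] {p : ℕ} (hp : p.Prime)
    (hpnorm : ‖(p : K)‖ = (p : ℝ)⁻¹)
    {r : ℝ} (hr : 0 < r) (a b : ℤ → K)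
    (ha : MemEr p r a) (hb : MemE p b)
    (hunit : HasSum (fun i : ℤ => a i * b (0 - i)) 1)
    (hzero : ∀ n : ℤ, n ≠ 0 → HasSum (fun i : ℤ => a i * b (n - i)) 0) :
    MemEr p r b := by
  have hp1 : 1 < (p:ℝ) := by exact_mod_cast hp.one_lt
  have hp0 : 0 < (p:ℝ) := by linarith
  obtain ⟨haE, c, hc⟩ := ha
  obtain ⟨⟨A, hA⟩, ha'⟩ := aux_memE hp1 a haE
  obtain ⟨⟨B, hB⟩, hb'⟩ := aux_memE hp1 b hb
  have hs0 : 0 < 1 / r := by positivity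
  have hC : ∀ i : ℤ, i < 0 → ‖a i‖ * (-(i:ℝ)) ^ (1 / r) ≤ (p:ℝ) ^ (-c) := by
    intro i hi
    have hi' : (i:ℝ) < 0 := by exact_mod_cast hi
    by_cases h : a i = 0
    · rw [h, norm_zero, zero_mul]; positivity
    · exact (aux_decay hp1 _ h _ _ _ (by linarith)).1 (hc i hi h)
  have hmul : ∀ i j, ‖a i‖ * ‖b j‖ ≤ 1 := by
    refine aux_mult a b A B hA hB ha' hb' (fun n => if n = 0 then 1 else 0) ?_ ?_
    · intro n
      split_ifs <;> simp
    · intro n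
      by_cases h : n = 0
      · subst h; simpa using hunit
      · simpa [h] using hzero n h
  obtain ⟨i1, hi1⟩ : ∃ i, 1 ≤ ‖a i‖ * ‖b (0 - i)‖ := by
    by_contra hcon
    push Not at hcon
    have := aux_sum_lt hunit one_pos (fun i => by rw [norm_mul]; exact hcon i)
    simp at this
  have hbp : 0 < ‖b (0 - i1)‖ := by
    rcases (norm_nonneg (b (0 - i1))).eq_or_lt with h | h
    · rw [← h] at hi1; simp at hi1; linarith
    · exact h
  have hap : 0 < ‖a i1‖ := by
    rcases (norm_nonneg (a i1)).eq_or_lt with h | h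
    · rw [← h] at hi1; simp at hi1; linarith
    · exact h
  have hmax : ∀ i, ‖a i‖ ≤ ‖a i1‖ := fun i =>
    le_of_mul_le_mul_right ((hmul i _).trans hi1) hbp
  obtain ⟨q, hq0, hqle, hqlt⟩ := aux_argmax _ (aux_tendsto a ha' i1) 0 (by simpa using hap)
  obtain ⟨m, hm⟩ : ∃ m : ℤ, m = i1 - q := ⟨_, rfl⟩
  rw [← hm] at hq0 hqle hqlt
  have hmle : ∀ i, ‖a i‖ ≤ ‖a m‖ := fun i => (hmax i).trans (by simpa using hqle 0)
  have hmlt : ∀ i < m, ‖a i‖ < ‖a m‖ := by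
    intro i hi
    convert hqlt (i1 - i).toNat (by omega) using 3; omega
  obtain ⟨C', hC'⟩ := aux_shift a A _ _ hs0 hA hC m
  have shiftlim : ∀ (x : ℤ → K) (k : ℤ), (∀ e : ℝ, 0 < e → ∃ N : ℤ, ∀ i ≤ N, ‖x i‖ < e) →
      (∀ e : ℝ, 0 < e → ∃ N : ℤ, ∀ i ≤ N, ‖x (k + i)‖ < e) := by
    intro x k hx e he
    obtain ⟨N, hN⟩ := hx e he
    exact ⟨N - k, fun i hi => hN _ (by omega)⟩
  obtain ⟨D, hD⟩ := aux_main (fun i => a (m + i)) (fun i => b (-m + i)) B C' (1 / r) hs0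
    (fun i => hB _) (shiftlim a m ha') (shiftlim b (-m) hb') hC' (by simpa using hq0)
    (by simpa using fun i => hmle (m + i))
    (by intro i hi; simpa using hmlt (m + i) (by omega))
    (by
      intro n hn
      have h := (Equiv.hasSum_iff (Equiv.addLeft m)).2 (hzero n hn.ne)
      convert h using 2 with i
      simp only [Function.comp, Equiv.coe_addLeft]
      congr 2
      ring)
  obtain ⟨D', hD'⟩ := aux_shift (fun i => b (-m + i)) B D (1 / r) hs0 (fun i => hB _) hD m
  refine ⟨hb, -Real.logb p (max D' 1), fun i hi hbi => ?_⟩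
  have hi' : (i:ℝ) < 0 := by exact_mod_cast hi
  rw [aux_decay hp1 _ hbi _ _ _ (by linarith), neg_neg, Real.rpow_logb hp0 hp1.ne' (by positivity)]
  have := hD' i hi
  simp only [neg_add_cancel_left] at this
  exact this.trans (le_max_left _ _)
end

section
/- Let L/F be a finite totally ramified Galois extension and let K be an intermediate field with K/F Galois and K ≠ F, L ≠ K. Then μ_{L/F} ≤ λ_{L/F}/|Gal(K/F)| + μ_{K/F}, where λ_{L/F} is the largest lower-numbering ramification break of L/F and μ_{L/F}, μ_{K/F} are the largest upper-numbering ramification breaks of L/F and K/F respectively. -/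
open scoped Classical

noncomputable section

variable {F L : Type*} [Field F] [Field L] [Algebra F L]

/-- The lower-numbering ramification set (convention of the paper):
`G_x = { g : v_L(g π_L − π_L) ≥ x }`, where `g` with `g π_L = π_L`
(in particular `g = 1`, with `v_L(0) = ∞`) belongs to every `G_x`. -/
def ramLower (vL : L → ℤ) (πL : L) (x : ℝ) : Set (L ≃ₐ[F] L) :=
  {g | g πL = πL ∨ x ≤ (vL (g πL - πL) : ℝ)}

/-- The Herbrand function `φ_{L/F}(x) = ∫_0^x dt/[G_0 : G_t]`
(`[G_0 : G_t] = |G_0|/|G_t|`). -/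
def herbrand (vL : L → ℤ) (πL : L) (x : ℝ) : ℝ :=
  ∫ t in (0:ℝ)..x,
    (Nat.card ↥(ramLower (F := F) vL πL t) : ℝ) /
      (Nat.card ↥(ramLower (F := F) vL πL 0) : ℝ)

/-- The upper-numbering ramification set, `G^{φ(x)} = G_x`,
i.e. `G^s = G_{φ⁻¹(s)}`. -/
def ramUpper (vL : L → ℤ) (πL : L) (s : ℝ) : Set (L ≃ₐ[F] L) :=
  ramLower (F := F) vL πL (Function.invFun (herbrand (F := F) vL πL) s)

/-- The largest lower-numbering ramification break
`λ_{L/F} = max_{g ≠ 1} v_L(g π_L − π_L)`. -/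
def lambdaBreak (vL : L → ℤ) (πL : L) : ℤ :=
  sSup ((fun g : L ≃ₐ[F] L => vL (g πL - πL)) '' {g | g ≠ 1})

/-- The largest upper-numbering ramification break `μ_{L/F} = φ_{L/F}(λ_{L/F})`. -/
def muBreak (vL : L → ℤ) (πL : L) : ℝ :=
  herbrand (F := F) vL πL ((lambdaBreak (F := F) vL πL : ℝ))

section Aux

theorem aux_val {F L : Type*} [Field F] [Field L] [Algebra F L]
    (vL : L → ℤ) (πL : L)
    (hmul : ∀ x y : L, x ≠ 0 → y ≠ 0 → vL (x * y) = vL x + vL y)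
    (hultra : ∀ x y : L, x ≠ 0 → y ≠ 0 → x + y ≠ 0 → min (vL x) (vL y) ≤ vL (x + y))
    (hGalinv : ∀ (g : L ≃ₐ[F] L) (x : L), x ≠ 0 → vL (g x) = vL x)
    (hπ0 : πL ≠ 0) (hπ1 : vL πL = 1) (g : L ≃ₐ[F] L) (hg : g πL ≠ πL) :
    1 ≤ vL (g πL - πL) := by
  have h1 := hmul (-πL) (-πL) (neg_ne_zero.2 hπ0) (neg_ne_zero.2 hπ0)
  rw [neg_mul_neg, hmul πL πL hπ0 hπ0] at h1
  have h2 := hultra (g πL) (-πL) (by simpa using hπ0) (neg_ne_zero.2 hπ0)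
    (by rw [← sub_eq_add_neg]; exact sub_ne_zero.2 hg)
  rw [← sub_eq_add_neg, hGalinv g πL hπ0] at h2
  have : vL (-πL) = 1 := by omega
  rw [this, hπ1] at h2
  simpa using h2

theorem aux_anti {F L : Type*} [Field F] [Field L] [Algebra F L] [FiniteDimensional F L]
    (vL : L → ℤ) (πL : L) :
    Antitone (fun t : ℝ => (Nat.card ↥(ramLower (F := F) vL πL t) : ℝ) /
      (Nat.card ↥(ramLower (F := F) vL πL 0) : ℝ)) := by
  intro a b hab
  dsimp only
  gcongr
  apply Nat.card_mono (Set.toFinite _)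
  rintro g (h | h)
  · exact Or.inl h
  · exact Or.inr (hab.trans h)

theorem aux_int {F L : Type*} [Field F] [Field L] [Algebra F L] [FiniteDimensional F L]
    (vL : L → ℤ) (πL : L) (a b : ℝ) :
    IntervalIntegrable (fun t : ℝ => (Nat.card ↥(ramLower (F := F) vL πL t) : ℝ) /
      (Nat.card ↥(ramLower (F := F) vL πL 0) : ℝ)) MeasureTheory.volume a b :=
  (aux_anti vL πL).intervalIntegrable

theorem aux_sub {F L : Type*} [Field F] [Field L] [Algebra F L] [FiniteDimensional F L]
    (vL : L → ℤ) (πL : L) (a b : ℝ) :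
    herbrand (F := F) vL πL b - herbrand (F := F) vL πL a = ∫ t in a..b,
    (Nat.card ↥(ramLower (F := F) vL πL t) : ℝ) /
      (Nat.card ↥(ramLower (F := F) vL πL 0) : ℝ) := by
  unfold herbrand
  exact intervalIntegral.integral_interval_sub_left (aux_int vL πL _ _) (aux_int vL πL _ _)

theorem aux_low {F L : Type*} [Field F] [Field L] [Algebra F L] [FiniteDimensional F L]
    (vL : L → ℤ) (πL : L) : ∃ c : ℝ, 0 < c ∧ ∀ a b : ℝ, a ≤ b → c * (b - a) ≤
    herbrand (F := F) vL πL b - herbrand (F := F) vL πL a := by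
  have pos : ∀ t : ℝ, 0 < Nat.card ↥(ramLower (F := F) vL πL t) := by
    intro t
    have : Nonempty ↥(ramLower (F := F) vL πL t) := ⟨⟨1, Or.inl rfl⟩⟩
    exact Nat.card_pos
  have pos0 : (0:ℝ) < Nat.card ↥(ramLower (F := F) vL πL 0) := by exact_mod_cast pos 0
  refine ⟨1 / (Nat.card ↥(ramLower (F := F) vL πL 0) : ℝ), by positivity, ?_⟩
  intro a b hab
  rw [aux_sub]
  have h := intervalIntegral.integral_mono_on (μ := MeasureTheory.volume)
    (f := fun _ => 1 / (Nat.card ↥(ramLower (F := F) vL πL 0) : ℝ)) hab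
    (by simp) (aux_int (F := F) vL πL a b) (by
      intro t _
      gcongr
      exact_mod_cast pos t)
  rw [intervalIntegral.integral_const, smul_eq_mul, mul_comm] at h
  exact h

theorem aux_mono {F L : Type*} [Field F] [Field L] [Algebra F L] [FiniteDimensional F L]
    (vL : L → ℤ) (πL : L) : StrictMono (herbrand (F := F) vL πL) := by
  obtain ⟨c, hc, h⟩ := aux_low (F := F) vL πL
  intro a b hab
  have := h a b hab.le
  have : 0 < c * (b - a) := mul_pos hc (sub_pos.2 hab)
  linarith

theorem aux_zero {F L : Type*} [Field F] [Field L] [Algebra F L]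
    (vL : L → ℤ) (πL : L) : herbrand (F := F) vL πL 0 = 0 := by
  simp [herbrand]

theorem aux_surj {F L : Type*} [Field F] [Field L] [Algebra F L] [FiniteDimensional F L]
    (vL : L → ℤ) (πL : L) : Function.Surjective (herbrand (F := F) vL πL) := by
  obtain ⟨c, hc, h⟩ := aux_low (F := F) vL πL
  have cont : Continuous (herbrand (F := F) vL πL) :=
    intervalIntegral.continuous_primitive (fun a b => aux_int vL πL a b) 0
  have h0 := aux_zero (F := F) vL πL
  apply cont.surjective
  · apply Filter.tendsto_atTop_mono' _ _ (Filter.tendsto_id.const_mul_atTop hc)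
    filter_upwards [Filter.eventually_ge_atTop 0] with x hx
    have := h 0 x hx
    simp only [h0, sub_zero] at this
    exact this
  · apply Filter.tendsto_atBot_mono' _ _ (Filter.tendsto_id.const_mul_atBot hc)
    filter_upwards [Filter.eventually_le_atBot 0] with x hx
    have := h x 0 hx
    simp only [h0, id] at this ⊢
    linarith

theorem aux_inv {F L : Type*} [Field F] [Field L] [Algebra F L] [FiniteDimensional F L]
    (vL : L → ℤ) (πL : L) (x : ℝ) :
    Function.invFun (herbrand (F := F) vL πL) (herbrand (F := F) vL πL x) = x :=
  Function.leftInverse_invFun (aux_mono vL πL).injective x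

theorem aux_lambda {F L : Type*} [Field F] [Field L] [Algebra F L] [FiniteDimensional F L]
    (vL : L → ℤ) (πL : L) (g : L ≃ₐ[F] L) (hg : g ≠ 1) :
    vL (g πL - πL) ≤ lambdaBreak (F := F) vL πL := by
  unfold lambdaBreak
  exact le_csSup (Set.toFinite _).bddAbove ⟨g, hg, rfl⟩

theorem aux_lambda_nonneg {F L : Type*} [Field F] [Field L] [Algebra F L]
    [FiniteDimensional F L]
    (vL : L → ℤ) (πL : L) (hfaith : ∀ g : L ≃ₐ[F] L, g πL = πL → g = 1)
    (h : ∀ g : L ≃ₐ[F] L, g πL ≠ πL → 1 ≤ vL (g πL - πL)) :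
    0 ≤ lambdaBreak (F := F) vL πL := by
  by_cases hex : ∃ g : L ≃ₐ[F] L, g ≠ 1
  · obtain ⟨g, hg⟩ := hex
    have := aux_lambda vL πL g hg
    have := h g (fun h' => hg (hfaith g h'))
    omega
  · have : {g : L ≃ₐ[F] L | g ≠ 1} = ∅ := by
      ext g; simp only [Set.mem_setOf_eq, Set.mem_empty_iff_false, iff_false]
      exact fun hg => hex ⟨g, hg⟩
    unfold lambdaBreak
    rw [this]; simp

end Aux

/-- Let `L/F` be a finite totally ramified Galois extension
and `K` an intermediate field, Galois over `F`, with `K ≠ F` and `L ≠ K`.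
Then `μ_{L/F} ≤ λ_{L/F}/|Gal(K/F)| + μ_{K/F}`. -/
theorem statement6 {K : Type*} [Field K] [Algebra F K] [Algebra K L]
    [IsScalarTower F K L]
    [FiniteDimensional F L] [IsGalois F L]
    [FiniteDimensional F K] [IsGalois F K]
    (vL : L → ℤ) (πL : L)
    -- `vL` is the normalized valuation of `L` (junk value at `0`):
    (hmul : ∀ x y : L, x ≠ 0 → y ≠ 0 → vL (x * y) = vL x + vL y)
    (hultra : ∀ x y : L, x ≠ 0 → y ≠ 0 → x + y ≠ 0 → min (vL x) (vL y) ≤ vL (x + y))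
    (hGalinv : ∀ (g : L ≃ₐ[F] L) (x : L), x ≠ 0 → vL (g x) = vL x)
    (hπ0 : πL ≠ 0) (hπ1 : vL πL = 1)
    -- `L/F` is totally ramified: the uniformizer `T` of `F` has `v_L(T) = [L:F]`
    -- and the value group of `F` is `[L:F]·ℤ`; hence the unique extension to `L`
    -- of the normalized valuation `v` of `F` is `v = vL/[L:F]`:
    (tF : F) (htF0 : tF ≠ 0)
    (htF : vL (algebraMap F L tF) = Module.finrank F L)
    (htot : ∀ x : F, x ≠ 0 → ((Module.finrank F L : ℤ)) ∣ vL (algebraMap F L x))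
    -- a uniformizer of a totally ramified extension of complete local fields
    -- generates, so only the identity fixes it:
    (hfaith : ∀ g : L ≃ₐ[F] L, g πL = πL → g = 1)
    -- the corresponding data for the intermediate extension `K/F`,
    -- with its normalized valuation `vK` compatible with `vL`:
    (vK : K → ℤ) (πK : K)
    (hmulK : ∀ x y : K, x ≠ 0 → y ≠ 0 → vK (x * y) = vK x + vK y)
    (hultraK : ∀ x y : K, x ≠ 0 → y ≠ 0 → x + y ≠ 0 → min (vK x) (vK y) ≤ vK (x + y))
    (hGalinvK : ∀ (g : K ≃ₐ[F] K) (x : K), x ≠ 0 → vK (g x) = vK x)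
    (hπK0 : πK ≠ 0) (hπK1 : vK πK = 1)
    (hfaithK : ∀ g : K ≃ₐ[F] K, g πK = πK → g = 1)
    (hcomp : ∀ x : K, x ≠ 0 →
      vL (algebraMap K L x) = (Module.finrank K L : ℤ) * vK x)
    -- compatibility of the upper-numbering filtration with quotients
    -- (`Gal(K/F)^s` is the image of `Gal(L/F)^s` under restriction):
    (hquot : ∀ s : ℝ, ramUpper (F := F) vK πK s =
      (fun g : L ≃ₐ[F] L => AlgEquiv.restrictNormal g K) '' ramUpper (F := F) vL πL s)
    -- `K ≠ F` and `L ≠ K`: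
    (hKF : 1 < Module.finrank F K) (hLK : 1 < Module.finrank K L) :
    muBreak (F := F) vL πL ≤
      (lambdaBreak (F := F) vL πL : ℝ) / (Nat.card (K ≃ₐ[F] K) : ℝ) +
        muBreak (F := F) vK πK := by
  have hvL := aux_val vL πL hmul hultra hGalinv hπ0 hπ1
  have hvK := aux_val vK πK hmulK hultraK hGalinvK hπK0 hπK1
  have hlL : (0:ℝ) ≤ lambdaBreak (F := F) vL πL := by
    exact_mod_cast aux_lambda_nonneg vL πL hfaith hvL
  have hlK : (0:ℝ) ≤ lambdaBreak (F := F) vK πK := by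
    exact_mod_cast aux_lambda_nonneg vK πK hfaithK hvK
  have hmK : 0 ≤ muBreak (F := F) vK πK := by
    unfold muBreak
    rw [← aux_zero (F := F) vK πK]
    exact (aux_mono vK πK).monotone hlK
  obtain ⟨y, hy⟩ := aux_surj (F := F) vL πL (muBreak (F := F) vK πK)
  have hy0 : 0 ≤ y := by
    rw [← (aux_mono (F := F) vL πL).le_iff_le, hy, aux_zero]; exact hmK
  have hm : (0:ℝ) < Nat.card (K ≃ₐ[F] K) := by exact_mod_cast Nat.card_pos
  rcases le_or_gt (lambdaBreak (F := F) vL πL : ℝ) y with hly | hly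
  · have h1 : muBreak (F := F) vL πL ≤ muBreak (F := F) vK πK := by
      rw [← hy]; exact (aux_mono vL πL).monotone hly
    have : 0 ≤ (lambdaBreak (F := F) vL πL : ℝ) / (Nat.card (K ≃ₐ[F] K) : ℝ) := by positivity
    linarith
  -- key: ramification groups beyond `y` restrict trivially
  have hker : ∀ t : ℝ, y < t → ramLower (F := F) vL πL t ⊆
      ((AlgEquiv.restrictNormalHom (F := F) (K₁ := L) K).ker : Set (L ≃ₐ[F] L)) := by
    intro t ht g hg
    obtain ⟨x, hx⟩ := aux_surj (F := F) vK πK (herbrand (F := F) vL πL t)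
    have hmem : AlgEquiv.restrictNormal g K ∈
        ramUpper (F := F) vK πK (herbrand (F := F) vL πL t) := by
      rw [hquot]
      refine ⟨g, ?_, rfl⟩
      unfold ramUpper
      rw [aux_inv]; exact hg
    unfold ramUpper at hmem
    rw [← hx, aux_inv] at hmem
    have hxl : (lambdaBreak (F := F) vK πK : ℝ) < x := by
      rw [← (aux_mono (F := F) vK πK).lt_iff_lt, hx]
      change muBreak (F := F) vK πK < _
      rw [← hy]
      exact aux_mono vL πL ht
    rw [SetLike.mem_coe, MonoidHom.mem_ker]
    change AlgEquiv.restrictNormal g K = 1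
    rcases hmem with h | h
    · exact hfaithK _ h
    · by_contra hne
      have h2 : ((vK (AlgEquiv.restrictNormal g K πK - πK) : ℤ) : ℝ)
        ≤ lambdaBreak (F := F) vK πK := by exact_mod_cast aux_lambda vK πK _ hne
      linarith
  have hcard : (Nat.card (AlgEquiv.restrictNormalHom (F := F) (K₁ := L) K).ker : ℝ) *
      Nat.card (K ≃ₐ[F] K) = Nat.card (L ≃ₐ[F] L) := by
    have h1 := Subgroup.card_mul_index (AlgEquiv.restrictNormalHom (F := F) (K₁ := L) K).ker
    rw [Subgroup.index_ker, MonoidHom.range_eq_top.2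
      (AlgEquiv.restrictNormalHom_surjective (F := F) (K₁ := K) L), Subgroup.card_top] at h1
    exact_mod_cast h1
  have hG0 : Nat.card ↥(ramLower (F := F) vL πL 0) = Nat.card (L ≃ₐ[F] L) := by
    have : ramLower (F := F) vL πL 0 = Set.univ := by
      ext g
      simp only [Set.mem_univ, iff_true]
      by_cases hg : g πL = πL
      · exact Or.inl hg
      · right
        have := hvL g hg
        exact_mod_cast (by omega : 0 ≤ vL (g πL - πL))
    rw [this]; exact Nat.card_congr (Equiv.Set.univ _)
  have hn : (0:ℝ) < Nat.card (L ≃ₐ[F] L) := by exact_mod_cast Nat.card_pos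
  have hint : herbrand (F := F) vL πL (lambdaBreak (F := F) vL πL : ℝ) -
      herbrand (F := F) vL πL y ≤
      ((lambdaBreak (F := F) vL πL : ℝ) - y) * (1 / (Nat.card (K ≃ₐ[F] K) : ℝ)) := by
    rw [aux_sub]
    have h := intervalIntegral.integral_mono_on_of_le_Ioo (μ := MeasureTheory.volume)
      (g := fun _ => 1 / (Nat.card (K ≃ₐ[F] K) : ℝ)) hly.le
      (aux_int (F := F) vL πL y _) (by simp) (by
        intro t ht
        rw [hG0, div_le_div_iff₀ hn hm, one_mul, ← hcard]
        gcongr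
        exact Nat.card_mono (Set.toFinite _) (hker t ht.1))
    rw [intervalIntegral.integral_const, smul_eq_mul] at h
    exact h
  rw [hy] at hint
  change muBreak (F := F) vL πL - _ ≤ _ at hint
  have h3 : ((lambdaBreak (F := F) vL πL : ℝ) - y) * (1 / (Nat.card (K ≃ₐ[F] K) : ℝ)) ≤
      (lambdaBreak (F := F) vL πL : ℝ) / (Nat.card (K ≃ₐ[F] K) : ℝ) := by
    rw [mul_one_div]
    gcongr
    linarith
  linarith
end
end

section
/- Let L/F be a finite totally ramified Galois extension with L ≠ F and group G, with largest upper-numbering ramification break μ = μ_{L/F}, and let δ_{L/F} = Σ_{g≠1} v_L(g(π_L) − π_L) be the valuation of the different of L/F. Then μ/|G^{μ}| ≤ δ_{L/F}/|G|. -/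
open scoped Classical

noncomputable section

variable {F L : Type*} [Field F] [Field L] [Algebra F L]

theorem aux_card_anti [FiniteDimensional F L] (vL : L → ℤ) (πL : L) :
    Antitone (fun t : ℝ => (Nat.card ↥(ramLower (F := F) vL πL t) : ℝ) /
      (Nat.card ↥(ramLower (F := F) vL πL 0) : ℝ)) := by
  intro a b hab
  have : Nat.card ↥(ramLower (F := F) vL πL b) ≤ Nat.card ↥(ramLower (F := F) vL πL a) := by
    apply Nat.card_mono (Set.toFinite _)
    rintro g (hg | hg)
    · exact Or.inl hg
    · exact Or.inr (hab.trans hg)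
  dsimp only
  gcongr

theorem aux_card_pos [FiniteDimensional F L] (vL : L → ℤ) (πL : L) (t : ℝ) :
    0 < Nat.card ↥(ramLower (F := F) vL πL t) := by
  haveI : Nonempty ↥(ramLower (F := F) vL πL t) := ⟨⟨1, Or.inl rfl⟩⟩
  exact Nat.card_pos

theorem aux_strictMono [FiniteDimensional F L] (vL : L → ℤ) (πL : L) :
    StrictMono (herbrand (F := F) vL πL) := by
  intro a b hab
  have hI : ∀ x y : ℝ, IntervalIntegrable (fun t : ℝ =>
      (Nat.card ↥(ramLower (F := F) vL πL t) : ℝ) /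
      (Nat.card ↥(ramLower (F := F) vL πL 0) : ℝ)) MeasureTheory.volume x y :=
    fun x y => (aux_card_anti vL πL).intervalIntegrable
  have h1 := intervalIntegral.integral_interval_sub_left (hI 0 b) (hI 0 a)
  have h2 : 0 < ∫ t in a..b, (Nat.card ↥(ramLower (F := F) vL πL t) : ℝ) /
      (Nat.card ↥(ramLower (F := F) vL πL 0) : ℝ) := by
    apply intervalIntegral.intervalIntegral_pos_of_pos (hI a b) _ hab
    intro t
    have := aux_card_pos (F := F) vL πL t
    have := aux_card_pos (F := F) vL πL 0
    positivity
  unfold herbrand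
  linarith

theorem aux_card [FiniteDimensional F L] (vL : L → ℤ) (πL : L)
    (hfaith : ∀ g : L ≃ₐ[F] L, g πL = πL → g = 1) (t : ℝ) :
    (Nat.card ↥(ramLower (F := F) vL πL t) : ℝ) =
      1 + ∑ g ∈ Finset.univ.filter (fun g : L ≃ₐ[F] L => g ≠ 1),
        Set.indicator {x : ℝ | x ≤ (vL (g πL - πL) : ℝ)} (fun _ => (1:ℝ)) t := by
  have h : ramLower (F := F) vL πL t = ((insert 1 (((Finset.univ.filter
      (fun g : L ≃ₐ[F] L => g ≠ 1)).filter
        (fun g => t ≤ (vL (g πL - πL) : ℝ)))) : Finset (L ≃ₐ[F] L)) : Set (L ≃ₐ[F] L)) := by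
    ext g
    simp only [ramLower, Set.mem_setOf_eq, Finset.coe_insert, Set.mem_insert_iff, Finset.mem_coe,
      Finset.mem_filter, Finset.mem_univ, true_and]
    constructor
    · rintro (h | h)
      · exact Or.inl (hfaith g h)
      · by_cases hg : g = 1
        · exact Or.inl hg
        · exact Or.inr ⟨hg, h⟩
    · rintro (h | h)
      · left; rw [h]; rfl
      · exact Or.inr h.2
  rw [h, Nat.card_coe_set_eq, Set.ncard_coe_finset, Finset.card_insert_of_notMem (by simp)]
  simp only [Set.indicator_apply, Set.mem_setOf_eq, Finset.sum_boole]
  push_cast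
  ring

/-- Let `L/F` be a finite totally ramified Galois extension
with `L ≠ F` and group `G`, with largest upper-numbering break `μ = μ_{L/F}`,
and let `δ_{L/F} = Σ_{g ≠ 1} v_L(g π_L − π_L)` be the valuation of the
different of `L/F`.  Then `μ/|G^μ| ≤ δ_{L/F}/|G|`. -/
theorem statement10 [FiniteDimensional F L] [IsGalois F L]
    (vL : L → ℤ) (πL : L)
    -- `vL` is the normalized valuation of `L` (junk value at `0`):
    (hmul : ∀ x y : L, x ≠ 0 → y ≠ 0 → vL (x * y) = vL x + vL y)
    (hultra : ∀ x y : L, x ≠ 0 → y ≠ 0 → x + y ≠ 0 → min (vL x) (vL y) ≤ vL (x + y))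
    (hGalinv : ∀ (g : L ≃ₐ[F] L) (x : L), x ≠ 0 → vL (g x) = vL x)
    (hπ0 : πL ≠ 0) (hπ1 : vL πL = 1)
    -- `L/F` is totally ramified: the uniformizer `T` of `F` has `v_L(T) = [L:F]`
    -- and the value group of `F` is `[L:F]·ℤ`; hence the unique extension to `L`
    -- of the normalized valuation `v` of `F` is `v = vL/[L:F]`:
    (tF : F) (htF0 : tF ≠ 0)
    (htF : vL (algebraMap F L tF) = Module.finrank F L)
    (htot : ∀ x : F, x ≠ 0 → ((Module.finrank F L : ℤ)) ∣ vL (algebraMap F L x))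
    -- a uniformizer of a totally ramified extension of complete local fields
    -- generates, so only the identity fixes it:
    (hfaith : ∀ g : L ≃ₐ[F] L, g πL = πL → g = 1)
    -- `L ≠ F`:
    (hLF : 1 < Module.finrank F L) :
    muBreak (F := F) vL πL /
        (Nat.card ↥(ramUpper (F := F) vL πL (muBreak (F := F) vL πL)) : ℝ) ≤
      ((∑ g ∈ Finset.univ.filter (fun g : L ≃ₐ[F] L => g ≠ 1),
          vL (g πL - πL) : ℤ) : ℝ) / (Nat.card (L ≃ₐ[F] L) : ℝ) := by
  have hG2 : 1 < Nat.card (L ≃ₐ[F] L) := by rwa [IsGalois.card_aut_eq_finrank]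
  set S := Finset.univ.filter (fun g : L ≃ₐ[F] L => g ≠ 1) with hS
  have hne : ∃ g : L ≃ₐ[F] L, g ≠ 1 := by
    haveI := Finite.one_lt_card_iff_nontrivial.mp hG2
    exact exists_ne 1
  have hneg1 : vL (-1) = 0 := by
    have h1 := hmul 1 1 one_ne_zero one_ne_zero
    have h2 := hmul (-1) (-1) (by simp) (by simp)
    simp only [mul_one, neg_mul_neg] at h1 h2
    omega
  have hi1 : ∀ g : L ≃ₐ[F] L, g ≠ 1 → 1 ≤ vL (g πL - πL) := by
    intro g hg
    have hd : g πL + -πL ≠ 0 := by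
      intro h
      exact hg (hfaith g (by linear_combination h))
    have hu := hultra (g πL) (-πL) (by simpa using hπ0) (by simpa using hπ0) hd
    have hn := hmul (-1) πL (by simp) hπ0
    rw [neg_one_mul, hneg1, hπ1] at hn
    rw [hGalinv g πL hπ0, hπ1, hn] at hu
    rw [sub_eq_add_neg]
    simpa using hu
  set lam := lambdaBreak (F := F) vL πL with hlam
  have hfin : ((fun g : L ≃ₐ[F] L => vL (g πL - πL)) '' {g | g ≠ 1}).Finite := Set.toFinite _
  have hmem : lam ∈ ((fun g : L ≃ₐ[F] L => vL (g πL - πL)) '' {g | g ≠ 1}) := by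
    apply Int.csSup_mem _ hfin.bddAbove
    obtain ⟨g, hg⟩ := hne
    exact ⟨_, g, hg, rfl⟩
  have hle : ∀ g : L ≃ₐ[F] L, g ≠ 1 → vL (g πL - πL) ≤ lam := fun g hg =>
    le_csSup hfin.bddAbove ⟨g, hg, rfl⟩
  obtain ⟨g0, hg0, hg0l⟩ := hmem
  have hg0' : g0 ≠ 1 := hg0
  dsimp only at hg0l
  have hlam1 : 1 ≤ lam := hg0l ▸ hi1 g0 hg0
  set δ : ℤ := ∑ g ∈ S, vL (g πL - πL) with hδ
  have hδl : lam ≤ δ := by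
    rw [← hg0l]
    apply Finset.single_le_sum (f := fun g : L ≃ₐ[F] L => vL (g πL - πL))
    · intro g hg
      have := hi1 g (by simpa [hS] using hg)
      omega
    · simp [hS, hg0']
  have hup : ramUpper (F := F) vL πL (muBreak (F := F) vL πL) =
      ramLower (F := F) vL πL (lam : ℝ) := by
    unfold ramUpper muBreak
    rw [Function.leftInverse_invFun (aux_strictMono (F := F) vL πL).injective]
  have h0 : Nat.card ↥(ramLower (F := F) vL πL 0) = Nat.card (L ≃ₐ[F] L) := by
    have : ramLower (F := F) vL πL 0 = Set.univ := by
      ext g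
      simp only [ramLower, Set.mem_setOf_eq, Set.mem_univ, iff_true]
      by_cases hg : g = 1
      · left; rw [hg]; rfl
      · right
        have := hi1 g hg
        exact_mod_cast (by omega : (0:ℤ) ≤ vL (g πL - πL))
    rw [this, Nat.card_univ]
  have hmu : muBreak (F := F) vL πL = ((lam : ℝ) + (δ : ℝ)) / (Nat.card (L ≃ₐ[F] L) : ℝ) := by
    unfold muBreak herbrand
    rw [← hlam, intervalIntegral.integral_div, h0]
    congr 1
    simp_rw [aux_card (F := F) vL πL hfaith]
    have hint : ∀ g ∈ S, IntervalIntegrable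
        (Set.indicator {x : ℝ | x ≤ (vL (g πL - πL) : ℝ)} (fun _ => (1:ℝ)))
        MeasureTheory.volume 0 (lam : ℝ) := by
      intro g _
      apply Antitone.intervalIntegrable
      intro a b hab
      simp only [Set.indicator_apply, Set.mem_setOf_eq]
      split_ifs with h1 h2 <;> first | linarith | norm_num
    rw [intervalIntegral.integral_add (by simp) ((IntervalIntegrable.sum S hint).congr (by
      intro x _; simp [Finset.sum_apply, hS])), intervalIntegral.integral_finset_sum hint]
    congr 1
    · simp
    · rw [hδ]
      push_cast
      apply Finset.sum_congr rfl
      intro g hg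
      have hg1 : g ≠ 1 := by simpa [hS] using hg
      have ha := hi1 g hg1
      have hb := hle g hg1
      rw [intervalIntegral.integral_indicator]
      · simp
      · exact ⟨by exact_mod_cast (by omega : (0:ℤ) ≤ vL (g πL - πL)), by exact_mod_cast hb⟩
  have hm : 2 ≤ Nat.card ↥(ramLower (F := F) vL πL (lam : ℝ)) := by
    rw [Nat.card_coe_set_eq]
    apply (Set.one_lt_ncard (Set.toFinite _)).mpr
    refine ⟨1, Or.inl rfl, g0, Or.inr ?_, hg0'.symm⟩
    rw [hg0l]
  rw [hup, hmu, div_right_comm]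
  have hG0 : (0:ℝ) < Nat.card (L ≃ₐ[F] L) := by exact_mod_cast (by omega)
  have hm' : (2:ℝ) ≤ Nat.card ↥(ramLower (F := F) vL πL (lam : ℝ)) := by exact_mod_cast hm
  have h1 : (1:ℝ) ≤ lam := by exact_mod_cast hlam1
  have h2 : (lam:ℝ) ≤ δ := by exact_mod_cast hδl
  apply div_le_div_of_nonneg_right _ hG0.le
  rw [div_le_iff₀ (by linarith)]
  nlinarith
end
end

section
/- For every integer n ≥ 1 and every matrix L in GL_n(𝓔), there exists a matrix B in GL_n of the subring given by the image of 𝒪_K[[T]][T^{−1}][1/p] in 𝓔 (i.e. B and B^{−1} have entries in that subring) such that every entry of the product B·L lies in the image of K⟨T,T^{−1}⟩ in 𝓔. -/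
open Filter

/-- `x` lies in the image of `𝒪_K[[T]][T⁻¹][1/p]` in `𝓔`: its coefficient
sequence vanishes for `i ≪ 0` (a genuine Laurent series) and has bounded
norms (bounded denominators). -/
def IsLaurentElem {K E : Type*} [NormedField K] [Field E]
    (coeff : E →+ (ℤ → K)) (x : E) : Prop :=
  (∃ N : ℤ, ∀ i : ℤ, i < N → coeff x i = 0) ∧ ∃ C : ℝ, ∀ i : ℤ, ‖coeff x i‖ ≤ C

/-- `x` lies in the image of `K⟨T,T⁻¹⟩` (the `p`-adic completion of the
Laurent polynomials, with `p` inverted) in `𝓔`: its coefficients are bounded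
and tend to `0` in norm in both directions. -/
def IsTateElem {K E : Type*} [NormedField K] [Field E]
    (coeff : E →+ (ℤ → K)) (x : E) : Prop :=
  (∃ C : ℝ, ∀ i : ℤ, ‖coeff x i‖ ≤ C) ∧
    Tendsto (fun i : ℤ => ‖coeff x i‖) atTop (nhds 0) ∧
    Tendsto (fun i : ℤ => ‖coeff x i‖) atBot (nhds 0)


set_option linter.unusedSectionVars false

structure ESetup {K E : Type*} [NontriviallyNormedField K] [Field E]
    (coeff : E →+ (ℤ → K)) : Prop where
  inj : Function.Injective coeff
  one : coeff 1 = fun i : ℤ => if i = 0 then 1 else 0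
  mul : ∀ x y : E, ∀ n : ℤ,
      HasSum (fun i : ℤ => coeff x i * coeff y (n - i)) (coeff (x * y) n)
  bdd : ∀ x : E, ∃ C : ℝ, ∀ i, ‖coeff x i‖ ≤ C
  lim : ∀ x : E, ∀ ε : ℝ, 0 < ε → ∃ N : ℤ, ∀ i ≤ N, ‖coeff x i‖ ≤ ε
  surj : ∀ a : ℤ → K, (∃ C : ℝ, ∀ i, ‖a i‖ ≤ C) →
    (∀ ε : ℝ, 0 < ε → ∃ N : ℤ, ∀ i ≤ N, ‖a i‖ ≤ ε) → ∃ x : E, coeff x = a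

namespace ESetup

theorem hasSum_le {K : Type*} [NontriviallyNormedField K] [IsUltrametricDist K]
    {f : ℤ → K} {s : K} (h : HasSum f s) {c : ℝ} (hc : 0 ≤ c) (hf : ∀ i, ‖f i‖ ≤ c) : ‖s‖ ≤ c := by
  refine le_of_tendsto (Tendsto.norm h) (Eventually.of_forall fun F => ?_)
  exact IsUltrametricDist.norm_sum_le_of_forall_le_of_nonneg hc (fun i _ => hf i)

theorem hasSum_lt {K : Type*} [NontriviallyNormedField K] [IsUltrametricDist K]
    {f : ℤ → K} {s : K} (h : HasSum f s) {c : ℝ} (hc : 0 < c) (hf : ∀ i, ‖f i‖ < c) : ‖s‖ < c := by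
  have h1 : ∀ᶠ F in atTop, ‖s - ∑ i ∈ F, f i‖ < c := by
    have : Tendsto (fun F : Finset ℤ => s - ∑ i ∈ F, f i) atTop (nhds (s - s)) :=
      tendsto_const_nhds.sub h
    have := this.norm
    simp only [sub_self, norm_zero] at this
    exact this.eventually_lt_const hc
  obtain ⟨F, hF⟩ := h1.exists
  have h2 : ‖∑ i ∈ F, f i‖ < c := by
    rcases F.eq_empty_or_nonempty with rfl | hne
    · simpa using hc
    · obtain ⟨i, -, hi⟩ := IsUltrametricDist.exists_norm_finsetSum_le F f
      exact hi.trans_lt (hf i)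
  have : s = (s - ∑ i ∈ F, f i) + ∑ i ∈ F, f i := by ring
  rw [this]
  exact (IsUltrametricDist.norm_add_le_max _ _).trans_lt (max_lt hF h2)

theorem hasSum_dom {K : Type*} [NontriviallyNormedField K] [IsUltrametricDist K]
    {f : ℤ → K} {s : K} (h : HasSum f s) (i0 : ℤ) (h0 : f i0 ≠ 0)
    (hf : ∀ i, i ≠ i0 → ‖f i‖ < ‖f i0‖) : ‖s‖ = ‖f i0‖ := by
  have h1 := h.update i0 0
  have hlt : ‖(0 - f i0 + s)‖ < ‖f i0‖ := by
    refine hasSum_lt h1 (norm_pos_iff.mpr h0) fun i => ?_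
    by_cases hi : i = i0
    · subst hi; simpa using h0
    · simpa [hi] using hf i hi
  have : s = (0 - f i0 + s) + f i0 := by ring
  rw [this, IsUltrametricDist.norm_add_eq_max_of_norm_ne_norm hlt.ne, max_eq_right hlt.le]

theorem argmax (f : ℤ → ℝ) (i1 : ℤ) (hfin : {i | f i1 ≤ f i}.Finite) :
    ∃ i0, (∀ i, f i ≤ f i0) ∧ ∀ i < i0, f i < f i0 := by
  obtain ⟨a, ha, hmax⟩ := Set.exists_max_image _ f hfin ⟨i1, le_refl (f i1)⟩
  have hmax' : ∀ i, f i ≤ f a := fun i => by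
    by_cases h : f i1 ≤ f i
    · exact hmax i h
    · exact (not_le.mp h).le.trans ha
  have hfin2 : {i | f a ≤ f i}.Finite := hfin.subset fun i hi => le_trans (b := f a) ha hi
  obtain ⟨b, hb, hmin⟩ := Set.exists_min_image _ id hfin2 ⟨a, le_refl (f a)⟩
  refine ⟨b, fun i => (hmax' i).trans hb, fun i hi => ?_⟩
  by_contra hcon
  have := hmin i (le_trans (b := f b) hb (not_lt.mp hcon))
  simp only [id] at this
  omega

variable {K E : Type*} [NontriviallyNormedField K] [CompleteSpace K]
    [IsUltrametricDist K] [Field E] {coeff : E →+ (ℤ → K)}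

/-- product of two bounded -/
theorem bd_mul (S : ESetup coeff) {x y : E} {c d : ℝ} (hx : ∀ i, ‖coeff x i‖ ≤ c)
    (hy : ∀ i, ‖coeff y i‖ ≤ d) (i : ℤ) : ‖coeff (x * y) i‖ ≤ c * d := by
  have hc : 0 ≤ c := (norm_nonneg _).trans (hx 0)
  have hd : 0 ≤ d := (norm_nonneg _).trans (hy 0)
  refine hasSum_le (S.mul x y i) (mul_nonneg hc hd) fun j => ?_
  rw [norm_mul]
  exact mul_le_mul (hx _) (hy _) (norm_nonneg _) hc

theorem norm_one_coeff (S : ESetup coeff) (i : ℤ) : ‖coeff 1 i‖ ≤ 1 := by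
  rw [S.one]; dsimp only; split_ifs <;> simp

theorem fin_lem {f : ℤ → ℝ} {c : ℝ} {a b : ℤ} (h1 : ∀ i ≤ a, f i < c) (h2 : ∀ i, b ≤ i → f i < c) :
    {i | c ≤ f i}.Finite := by
  refine (Set.finite_Icc a b).subset fun i hi => ?_
  simp only [Set.mem_ofPred_eq] at hi
  constructor
  · by_contra h; exact absurd (h1 i (by omega)) (not_lt.mpr hi)
  · by_contra h; exact absurd (h2 i (by omega)) (not_lt.mpr hi)

/-- weighted truncated argmax -/
theorem wargmax (S : ESetup coeff) (x : E) (N : ℤ) (r : ℝ) (hr0 : 0 < r) (hr1 : r < 1)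
    (a : ℤ) (ha : N < a) (hxa : coeff x a ≠ 0) :
    ∃ i0, N < i0 ∧ (∀ i, N < i → ‖coeff x i‖ * r ^ i ≤ ‖coeff x i0‖ * r ^ i0) ∧
      ∀ i, N < i → i < i0 → ‖coeff x i‖ * r ^ i < ‖coeff x i0‖ * r ^ i0 := by
  classical
  set f : ℤ → ℝ := fun i => if N < i then ‖coeff x i‖ * r ^ i else 0 with hf
  have hfa : 0 < f a := by
    simp only [hf, ha, if_true]
    exact mul_pos (norm_pos_iff.mpr hxa) (zpow_pos hr0 _)
  have hfin : {i | f a ≤ f i}.Finite := by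
    obtain ⟨C, hC⟩ := S.bdd x
    have hC0 : 0 ≤ C := (norm_nonneg _).trans (hC 0)
    obtain ⟨m, hm⟩ := exists_pow_lt_of_lt_one (show 0 < f a / (C + 1) by positivity) hr1
    refine fin_lem (a := N) (b := (m : ℤ)) (fun i hi => ?_) (fun i hi => ?_)
    · simp only [hf, not_lt.mpr hi, if_false]; exact hfa
    · by_cases h : N < i
      · have e1 : r ^ i ≤ r ^ m := by
          rw [← zpow_natCast]
          exact zpow_le_zpow_right_of_le_one₀ hr0 hr1.le hi
        have e2 : f i ≤ C * r ^ m := by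
          simp only [hf, h, if_true]
          exact mul_le_mul (hC i) e1 (zpow_pos hr0 _).le hC0
        have e3 : r ^ m * (C + 1) < f a := by rwa [lt_div_iff₀ (by positivity)] at hm
        have : 0 < r ^ m := pow_pos hr0 _
        nlinarith
      · simp only [hf, h, if_false]; exact hfa
  obtain ⟨i0, h1, h2⟩ := argmax f a hfin
  have hN : N < i0 := by
    by_contra h
    have := h1 a
    have h0 : f i0 = 0 := by simp only [hf, h, if_false]
    linarith
  refine ⟨i0, hN, fun i hi => ?_, fun i hi hi' => ?_⟩
  · have := h1 i; simpa only [hf, hi, hN, if_true] using this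
  · have := h2 i hi'; simpa only [hf, hi, hN, if_true] using this

theorem gauss (S : ESetup coeff) {x y : E} (hxy : x * y = 1) (a b : ℤ) :
    ‖coeff x a‖ * ‖coeff y b‖ ≤ 1 := by
  by_contra hcon
  push Not at hcon
  obtain ⟨C, hC⟩ := S.bdd x
  obtain ⟨D, hD⟩ := S.bdd y
  have hC0 : 0 ≤ C := (norm_nonneg _).trans (hC 0)
  have hD0 : 0 ≤ D := (norm_nonneg _).trans (hD 0)
  set ε : ℝ := 1 / (C + D + 1) with hε
  have hε0 : 0 < ε := by positivity
  have hεm : ε * (C + D + 1) = 1 := by rw [hε]; field_simp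
  have hεC : ε * C < 1 := by nlinarith
  have hεD : ε * D < 1 := by nlinarith
  obtain ⟨N1, hN1⟩ := S.lim x ε hε0
  obtain ⟨N2, hN2⟩ := S.lim y ε hε0
  set N := min N1 N2
  have hx : ∀ i ≤ N, ‖coeff x i‖ ≤ ε := fun i hi => hN1 i (hi.trans (min_le_left _ _))
  have hy : ∀ i ≤ N, ‖coeff y i‖ ≤ ε := fun i hi => hN2 i (hi.trans (min_le_right _ _))
  have ha : N < a := by
    by_contra h
    have := mul_le_mul (hx a (not_lt.mp h)) (hD b) (norm_nonneg _) hε0.le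
    linarith
  have hb : N < b := by
    by_contra h
    have := mul_le_mul (hC a) (hy b (not_lt.mp h)) (norm_nonneg _) hC0
    linarith
  -- choose r
  obtain ⟨r, hr0, hr1, hr⟩ : ∃ r : ℝ, 0 < r ∧ r < 1 ∧
      1 < ‖coeff x a‖ * ‖coeff y b‖ * r ^ (a + b - 2 * N) := by
    have hcont : Tendsto (fun r : ℝ => ‖coeff x a‖ * ‖coeff y b‖ * r ^ (a + b - 2 * N))
        (nhdsWithin 1 (Set.Iio 1)) (nhds (‖coeff x a‖ * ‖coeff y b‖ * 1 ^ (a + b - 2 * N))) := by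
      refine Tendsto.mono_left ?_ nhdsWithin_le_nhds
      exact ((continuousAt_zpow₀ (1:ℝ) _ (Or.inl one_ne_zero)).tendsto).const_mul _
    rw [one_zpow, mul_one] at hcont
    have h1 := hcont.eventually_const_lt hcon
    have h2 : ∀ᶠ r : ℝ in nhdsWithin 1 (Set.Iio 1), r < 1 := eventually_mem_nhdsWithin
    have h3 : ∀ᶠ r : ℝ in nhdsWithin 1 (Set.Iio 1), 0 < r :=
      nhdsWithin_le_nhds (lt_mem_nhds one_pos)
    obtain ⟨r, hr⟩ := (h1.and (h2.and h3)).exists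
    exact ⟨r, hr.2.2, hr.2.1, hr.1⟩
  have hxa : coeff x a ≠ 0 := by rintro h; simp [h] at hcon; linarith
  have hyb : coeff y b ≠ 0 := by rintro h; simp [h] at hcon; linarith
  obtain ⟨i0, hi0, hi1, hi2⟩ := S.wargmax x N r hr0 hr1 a ha hxa
  obtain ⟨j0, hj0, hj1, hj2⟩ := S.wargmax y N r hr0 hr1 b hb hyb
  have hbig : 1 < ‖coeff x i0‖ * ‖coeff y j0‖ := by
    have e1 : (‖coeff x a‖ * r ^ a) * (‖coeff y b‖ * r ^ b) ≤
        (‖coeff x i0‖ * r ^ i0) * (‖coeff y j0‖ * r ^ j0) :=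
      mul_le_mul (hi1 a ha) (hj1 b hb) (by positivity) (by positivity)
    have e2 : ‖coeff x a‖ * ‖coeff y b‖ * r ^ (a + b - 2 * N) ≤
        ‖coeff x i0‖ * ‖coeff y j0‖ * r ^ (i0 + j0 - 2 * N) := by
      have : ∀ u v : ℤ, r ^ (u + v - 2 * N) = r ^ u * r ^ v * r ^ (-(2 * N)) := fun u v => by
        rw [← zpow_add₀ hr0.ne', ← zpow_add₀ hr0.ne']; congr 1
      rw [this, this]
      have := mul_le_mul_of_nonneg_right e1 (zpow_pos hr0 (-(2 * N))).le
      calc _ = _ := by ring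
        _ ≤ _ := this
        _ = _ := by ring
    have e3 : r ^ (i0 + j0 - 2 * N) ≤ 1 := by
      have := zpow_le_zpow_right_of_le_one₀ hr0 hr1.le (show 0 ≤ i0 + j0 - 2 * N by omega)
      simpa using this
    calc 1 < _ := hr
      _ ≤ _ := e2
      _ ≤ ‖coeff x i0‖ * ‖coeff y j0‖ * 1 := by gcongr
      _ = _ := mul_one _
  have hsum := S.mul x y (i0 + j0)
  rw [hxy] at hsum
  have hd := hasSum_dom hsum i0 (by
      rw [add_sub_cancel_left, ← norm_pos_iff, norm_mul]; linarith) (by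
    intro i hi
    rw [add_sub_cancel_left, norm_mul, norm_mul]
    by_cases h1 : i ≤ N
    · have := mul_le_mul (hx i h1) (hD (i0 + j0 - i)) (norm_nonneg _) hε0.le
      linarith
    by_cases h2 : i0 + j0 - i ≤ N
    · have := mul_le_mul (hC i) (hy _ h2) (norm_nonneg _) hC0
      linarith
    push Not at h1 h2
    have hprod : r ^ i * r ^ (i0 + j0 - i) = r ^ i0 * r ^ j0 := by
      rw [← zpow_add₀ hr0.ne', ← zpow_add₀ hr0.ne']; congr 1; ring
    have hpos : 0 < r ^ i0 * r ^ j0 := mul_pos (zpow_pos hr0 _) (zpow_pos hr0 _)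
    have hX0 : 0 < ‖coeff x i0‖ * r ^ i0 :=
      (mul_pos (norm_pos_iff.mpr hxa) (zpow_pos hr0 _)).trans_le (hi1 a ha)
    have hY0 : 0 < ‖coeff y j0‖ * r ^ j0 :=
      (mul_pos (norm_pos_iff.mpr hyb) (zpow_pos hr0 _)).trans_le (hj1 b hb)
    have key : (‖coeff x i‖ * r ^ i) * (‖coeff y (i0 + j0 - i)‖ * r ^ (i0 + j0 - i)) <
        (‖coeff x i0‖ * r ^ i0) * (‖coeff y j0‖ * r ^ j0) := by
      rcases lt_or_gt_of_ne hi with h | h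
      · exact (mul_le_mul_of_nonneg_left (hj1 _ h2) (by positivity)).trans_lt
          (mul_lt_mul_of_pos_right (hi2 i h1 h) hY0)
      · exact mul_lt_mul' (hi1 i h1) (hj2 _ h2 (by omega)) (by positivity) hX0
    have e : ‖coeff x i‖ * ‖coeff y (i0 + j0 - i)‖ * (r ^ i0 * r ^ j0) <
        ‖coeff x i0‖ * ‖coeff y j0‖ * (r ^ i0 * r ^ j0) := by
      calc ‖coeff x i‖ * ‖coeff y (i0 + j0 - i)‖ * (r ^ i0 * r ^ j0) =
          (‖coeff x i‖ * r ^ i) * (‖coeff y (i0 + j0 - i)‖ * r ^ (i0 + j0 - i)) := by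
            rw [← hprod]; ring
        _ < _ := key
        _ = _ := by ring
    exact lt_of_mul_lt_mul_right e hpos.le)
  rw [add_sub_cancel_left, norm_mul] at hd
  have := S.norm_one_coeff (i0 + j0)
  linarith

/-- sup attained -/
theorem lead (S : ESetup coeff) {x : E} (hx0 : x ≠ 0) :
    ∃ i0, coeff x i0 ≠ 0 ∧ (∀ i, ‖coeff x i‖ ≤ ‖coeff x i0‖) ∧
      ∀ i < i0, ‖coeff x i‖ < ‖coeff x i0‖ := by
  have hxy : x * x⁻¹ = 1 := mul_inv_cancel₀ hx0
  have hs := S.mul x x⁻¹ 0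
  rw [hxy] at hs
  obtain ⟨i, hi⟩ : ∃ i, 1 ≤ ‖coeff x i * coeff x⁻¹ (0 - i)‖ := by
    by_contra h
    push Not at h
    have := hasSum_lt hs one_pos h
    rw [S.one] at this
    simp at this
  rw [norm_mul] at hi
  have hy : 0 < ‖coeff x⁻¹ (0 - i)‖ := by
    rcases (norm_nonneg (coeff x⁻¹ (0 - i))).eq_or_lt with h | h
    · rw [← h] at hi; linarith
    · exact h
  have hmax : ∀ a, ‖coeff x a‖ ≤ ‖coeff x i‖ := fun a =>
    le_of_mul_le_mul_right ((S.gauss hxy a (0 - i)).trans hi) hy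
  have hxi : 0 < ‖coeff x i‖ := by
    rcases (norm_nonneg (coeff x i)).eq_or_lt with h | h
    · rw [← h] at hi; linarith
    · exact h
  obtain ⟨N, hN⟩ := S.lim x (‖coeff x i‖ / 2) (by linarith)
  obtain ⟨b, hb, hmin⟩ := Int.exists_least_of_bdd (P := fun j => ‖coeff x i‖ ≤ ‖coeff x j‖)
    ⟨N, fun z hz => by
      by_contra h
      have := hN z (by omega)
      linarith⟩ ⟨i, le_rfl⟩
  refine ⟨b, norm_pos_iff.mp (hxi.trans_le hb), fun j => (hmax j).trans hb, fun j hj => ?_⟩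
  by_contra h
  have := hmin j (hb.trans (not_lt.mp h))
  omega

open Classical in
theorem exists_trunc (S : ESetup coeff) (s : Set ℤ) (x : E) :
    ∃ y : E, ∀ i, coeff y i = if i ∈ s then coeff x i else 0 := by
  obtain ⟨C, hC⟩ := S.bdd x
  obtain ⟨y, hy⟩ := S.surj (fun i => if i ∈ s then coeff x i else 0) ⟨C, fun i => by
      split_ifs
      · exact hC i
      · simpa using (norm_nonneg _).trans (hC 0)⟩ (fun ε hε => by
      obtain ⟨N, hN⟩ := S.lim x ε hε
      refine ⟨N, fun i hi => ?_⟩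
      split_ifs
      · exact hN i hi
      · simpa using hε.le)
  exact ⟨y, fun i => by rw [hy]⟩

/-- finite-tailed -/
def Lau (coeff : E →+ (ℤ → K)) (x : E) : Prop := ∃ N : ℤ, ∀ i < N, coeff x i = 0

theorem lau_mul (S : ESetup coeff) {x y : E} (hx : Lau coeff x) (hy : Lau coeff y) :
    Lau coeff (x * y) := by
  obtain ⟨N, hN⟩ := hx
  obtain ⟨M, hM⟩ := hy
  refine ⟨N + M, fun n hn => ?_⟩
  have h := S.mul x y n
  have : (fun i : ℤ => coeff x i * coeff y (n - i)) = fun _ => 0 := by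
    funext i
    by_cases hi : i < N
    · rw [hN i hi, zero_mul]
    · rw [hM (n - i) (by omega), mul_zero]
  rw [this] at h
  exact h.unique hasSum_zero

def lauRing (S : ESetup coeff) : Subring E where
  carrier := {x | Lau coeff x}
  mul_mem' := fun hx hy => S.lau_mul hx hy
  one_mem' := ⟨0, fun i hi => by rw [S.one]; simp; omega⟩
  zero_mem' := ⟨0, fun i hi => by simp⟩
  add_mem' := by
    rintro x y ⟨N, hN⟩ ⟨M, hM⟩
    refine ⟨min N M, fun i hi => ?_⟩
    rw [map_add, Pi.add_apply, hN i (by omega), hM i (by omega), add_zero]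
  neg_mem' := by
    rintro x ⟨N, hN⟩
    refine ⟨N, fun i hi => ?_⟩
    rw [map_neg, Pi.neg_apply, hN i hi, neg_zero]

theorem mem_lau (S : ESetup coeff) {x : E} : x ∈ S.lauRing ↔ ∃ N : ℤ, ∀ i < N, coeff x i = 0 :=
  Iff.rfl

def bdSub (coeff : E →+ (ℤ → K)) (c : ℝ) (hc : 0 ≤ c) : AddSubgroup E where
  carrier := {x | ∀ i, ‖coeff x i‖ ≤ c}
  zero_mem' := fun i => by simpa using hc
  add_mem' := fun {x y} hx hy i => by
    rw [map_add, Pi.add_apply]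
    exact (IsUltrametricDist.norm_add_le_max _ _).trans (max_le (hx i) (hy i))
  neg_mem' := fun {x} hx i => by
    rw [map_neg, Pi.neg_apply, norm_neg]; exact hx i

/-- `r` dominated by its lowest coefficient has Laurent inverse -/
theorem lau_inv (S : ESetup coeff) {x : E} (i0 : ℤ) (h0 : coeff x i0 ≠ 0)
    (h1 : ∀ i, ‖coeff x i‖ ≤ ‖coeff x i0‖) (h2 : ∀ i < i0, coeff x i = 0) : Lau coeff x⁻¹ := by
  classical
  have hx0 : x ≠ 0 := by rintro rfl; simp at h0
  refine ⟨-i0, fun j hj => ?_⟩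
  by_contra hne
  set f : ℤ → ℝ := fun i => if i < -i0 then ‖coeff x⁻¹ i‖ else 0 with hf
  have hfj : 0 < f j := by simp only [hf, hj, if_true]; exact norm_pos_iff.mpr hne
  obtain ⟨N, hN⟩ := S.lim x⁻¹ (f j / 2) (by linarith)
  obtain ⟨i1, hm1, hm2⟩ := argmax f j (fin_lem (a := N) (b := -i0) (fun i hi => by
      have := hN i hi
      simp only [hf] at hfj this ⊢
      split_ifs at * <;> linarith) (fun i hi => by
      simp only [hf, not_lt.mpr hi, if_false]; exact hfj))
  have hi1 : i1 < -i0 := by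
    by_contra h
    have := hm1 j
    have h0 : f i1 = 0 := by simp only [hf, h, if_false]
    linarith
  have hfi1 : f i1 = ‖coeff x⁻¹ i1‖ := by simp only [hf, hi1, if_true]
  have hy1 : 0 < ‖coeff x⁻¹ i1‖ := by rw [← hfi1]; exact hfj.trans_le (hm1 j)
  have hsum := S.mul x x⁻¹ (i0 + i1)
  rw [mul_inv_cancel₀ hx0] at hsum
  have hd := hasSum_dom hsum i0 (by
    rw [add_sub_cancel_left]; exact mul_ne_zero h0 (norm_pos_iff.mp hy1)) (by
    intro i hi
    rw [add_sub_cancel_left, norm_mul, norm_mul]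
    have hx0' := norm_pos_iff.mpr h0
    rcases lt_or_gt_of_ne hi with h | h
    · rw [h2 i h, norm_zero, zero_mul]; positivity
    · have hlt := hm2 (i0 + i1 - i) (by omega)
      rw [hfi1] at hlt
      simp only [hf, show i0 + i1 - i < -i0 by omega, if_true] at hlt
      exact mul_lt_mul' (h1 i) hlt (norm_nonneg _) hx0')
  rw [add_sub_cancel_left, norm_mul, S.one] at hd
  simp only [show i0 + i1 ≠ 0 by omega, if_false, norm_zero] at hd
  have := mul_pos (norm_pos_iff.mpr h0) hy1
  linarith

theorem unit_approx (S : ESetup coeff) {x : E} (hx0 : x ≠ 0) :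
    ∃ r : E, r ≠ 0 ∧ Lau coeff r ∧ Lau coeff r⁻¹ ∧
      ∃ q : ℝ, 0 ≤ q ∧ q < 1 ∧ ∀ i, ‖coeff (r⁻¹ * x - 1) i‖ ≤ q := by
  classical
  obtain ⟨i0, h0, h1, h2⟩ := S.lead hx0
  obtain ⟨r, hr⟩ := S.exists_trunc (Set.Ici i0) x
  obtain ⟨z, hz⟩ := S.exists_trunc (Set.Iio i0) x
  have hxrz : x = r + z := by
    apply S.inj
    funext i
    rw [map_add, Pi.add_apply, hr, hz]
    by_cases h : i0 ≤ i
    · simp [h]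
    · simp [h, not_le.mp h]
  have hri0 : coeff r i0 = coeff x i0 := by rw [hr]; simp
  have hr1 : ∀ i, ‖coeff r i‖ ≤ ‖coeff r i0‖ := fun i => by
    rw [hri0, hr]; split_ifs
    · exact h1 i
    · simp
  have hrz : ∀ i < i0, coeff r i = 0 := fun i hi => by
    rw [hr, if_neg]; simpa using hi
  have hr0 : r ≠ 0 := by rintro rfl; simp at hri0; exact h0 hri0.symm
  have hpos : 0 < ‖coeff x i0‖ := norm_pos_iff.mpr h0
  -- bound of z
  obtain ⟨c, hc0, hclt, hc⟩ : ∃ c : ℝ, 0 ≤ c ∧ c < ‖coeff x i0‖ ∧ ∀ i, ‖coeff z i‖ ≤ c := by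
    obtain ⟨N, hN⟩ := S.lim x (‖coeff x i0‖ / 2) (by linarith)
    by_cases hzz : z = 0
    · exact ⟨0, le_rfl, hpos, fun i => by simp [hzz]⟩
    · obtain ⟨j, hj, hj1, -⟩ := S.lead hzz
      refine ⟨_, norm_nonneg _, ?_, hj1⟩
      rw [hz]
      split_ifs with h
      · exact h2 j h
      · simpa using hpos
  refine ⟨r, hr0, ⟨i0, hrz⟩, S.lau_inv i0 (hri0 ▸ h0) hr1 hrz, ‖coeff x i0‖⁻¹ * c,
    by positivity, ?_, ?_⟩
  · rw [inv_mul_lt_iff₀ hpos, mul_one]; exact hclt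
  · have : r⁻¹ * x - 1 = r⁻¹ * z := by rw [hxrz]; field_simp; ring
    rw [this]
    refine S.bd_mul (fun i => ?_) hc
    have := S.gauss (mul_inv_cancel₀ hr0) i0 i
    rw [hri0] at this
    rw [inv_eq_one_div ‖coeff x i0‖, le_div_iff₀ hpos, mul_comm]; exact this

theorem complete (S : ESetup coeff) {q : ℝ} (hq0 : 0 ≤ q) (hq1 : q < 1) (x : ℕ → E)
    (hx : ∀ k i, ‖coeff (x (k + 1) - x k) i‖ ≤ q ^ k * q) :
    ∃ y, ∀ k i, ‖coeff (y - x k) i‖ ≤ q ^ k * q := by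
  have hstep : ∀ k m i, ‖coeff (x (k + m) - x k) i‖ ≤ q ^ k * q := by
    intro k m i
    induction m with
    | zero => simp; positivity
    | succ m ih =>
      have e : x (k + (m + 1)) - x k = (x (k + m + 1) - x (k + m)) + (x (k + m) - x k) := by
        rw [← add_assoc]; ring
      rw [e, map_add, Pi.add_apply]
      refine (IsUltrametricDist.norm_add_le_max _ _).trans (max_le ((hx _ i).trans ?_) ih)
      exact mul_le_mul_of_nonneg_right
        (pow_le_pow_of_le_one hq0 hq1.le (Nat.le_add_right k m)) hq0
  have hcau : ∀ i, CauchySeq (fun k => coeff (x k) i) := fun i => by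
    refine cauchySeq_of_le_geometric q q hq1 fun k => ?_
    rw [dist_comm, dist_eq_norm, ← Pi.sub_apply, ← map_sub, mul_comm]
    exact hx k i
  choose a ha using fun i => cauchySeq_tendsto_of_complete (hcau i)
  have hbd : ∀ k i, ‖a i - coeff (x k) i‖ ≤ q ^ k * q := fun k i => by
    refine le_of_tendsto (((ha i).sub_const (coeff (x k) i)).norm)
      (eventually_atTop.mpr ⟨k, fun m hm => ?_⟩)
    obtain ⟨j, rfl⟩ := Nat.exists_eq_add_of_le hm
    rw [← Pi.sub_apply, ← map_sub]
    exact hstep k j i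
  have hsplit : ∀ k i, ‖a i‖ ≤ max (q ^ k * q) ‖coeff (x k) i‖ := fun k i => by
    have := IsUltrametricDist.norm_add_le_max (a i - coeff (x k) i) (coeff (x k) i)
    rw [sub_add_cancel] at this
    exact this.trans (max_le_max (hbd k i) le_rfl)
  obtain ⟨y, hy⟩ := S.surj a (by
    obtain ⟨C, hC⟩ := S.bdd (x 0)
    exact ⟨max (q ^ 0 * q) C, fun i => (hsplit 0 i).trans (max_le_max le_rfl (hC i))⟩) (by
    intro ε hε
    obtain ⟨k, hk⟩ := exists_pow_lt_of_lt_one hε hq1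
    obtain ⟨N, hN⟩ := S.lim (x k) ε hε
    refine ⟨N, fun i hi => (hsplit k i).trans (max_le ?_ (hN i hi))⟩
    have : 0 ≤ q ^ k := by positivity
    nlinarith)
  refine ⟨y, fun k i => ?_⟩
  rw [map_sub, Pi.sub_apply, hy]
  exact hbd k i

variable {m : Type*} [Fintype m] [DecidableEq m]

def BdM (coeff : E →+ (ℤ → K)) (X : Matrix m m E) (c : ℝ) : Prop :=
  ∀ i j k, ‖coeff (X i j) k‖ ≤ c

theorem BdM.mono {X : Matrix m m E} {c d : ℝ} (h : BdM coeff X c) (hcd : c ≤ d) : BdM coeff X d :=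
  fun i j k => (h i j k).trans hcd

theorem BdM.add {X Y : Matrix m m E} {c : ℝ} (hX : BdM coeff X c) (hY : BdM coeff Y c) :
    BdM coeff (X + Y) c := fun i j k => by
  rw [Matrix.add_apply, map_add, Pi.add_apply]
  exact (IsUltrametricDist.norm_add_le_max _ _).trans (max_le (hX i j k) (hY i j k))

theorem BdM.neg {X : Matrix m m E} {c : ℝ} (hX : BdM coeff X c) :
    BdM coeff (-X) c := fun i j k => by
  rw [Matrix.neg_apply, map_neg, Pi.neg_apply, norm_neg]; exact hX i j k

theorem bdM_mul (S : ESetup coeff) {X Y : Matrix m m E} {c d : ℝ} (hc : 0 ≤ c) (hd : 0 ≤ d)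
    (hX : BdM coeff X c) (hY : BdM coeff Y d) : BdM coeff (X * Y) (c * d) := fun i j => by
  rw [Matrix.mul_apply]
  exact (bdSub coeff (c * d) (mul_nonneg hc hd)).sum_mem fun l _ =>
    S.bd_mul (hX i l) (hY l j)

theorem bdM_exists (S : ESetup coeff) (X : Matrix m m E) : ∃ C, 0 ≤ C ∧ BdM coeff X C := by
  have h : ∀ᶠ C : ℝ in atTop, ∀ i j k, ‖coeff (X i j) k‖ ≤ C := by
    refine eventually_all.mpr fun i => eventually_all.mpr fun j => ?_
    obtain ⟨C, hC⟩ := S.bdd (X i j)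
    filter_upwards [eventually_ge_atTop C] with D hD k using (hC k).trans hD
  obtain ⟨C, hC⟩ := (h.and (eventually_ge_atTop 0)).exists
  exact ⟨C, hC.2, hC.1⟩

theorem fixpt (S : ESetup coeff) {q : ℝ} (hq0 : 0 ≤ q) (hq1 : q < 1)
    (φ : Matrix m m E → Matrix m m E)
    (hφ : ∀ X Y c, 0 ≤ c → BdM coeff (X - Y) c → BdM coeff (φ X - φ Y) (q * c))
    (h0 : BdM coeff (φ 0) q) : ∃ X, φ X = X ∧ BdM coeff X q := by
  let s : ℕ → Matrix m m E := fun k => φ^[k] 0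
  have hs : ∀ k, s (k + 1) = φ (s k) := fun k => Function.iterate_succ_apply' φ k 0
  have hd : ∀ k, BdM coeff (s (k + 1) - s k) (q ^ k * q) := by
    intro k
    induction k with
    | zero => rw [hs]; simpa [s] using h0
    | succ k ih =>
      rw [hs (k + 1)]
      nth_rewrite 2 [hs k]
      rw [pow_succ, mul_comm (q ^ k) q, mul_assoc]
      have := hφ _ _ _ (by positivity) ih
      exact this
  choose X hX using fun i j => S.complete hq0 hq1 (fun k => s k i j) (fun k l => hd k i j l)
  have hX' : ∀ k, BdM coeff (Matrix.of X - s k) (q ^ k * q) := fun k i j l => hX i j k l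
  refine ⟨Matrix.of X, ?_, by simpa [s] using hX' 0⟩
  have hb : ∀ k, BdM coeff (φ (Matrix.of X) - Matrix.of X) (q ^ k) := fun k => by
    have h1 := hφ _ _ _ (by positivity) (hX' k)
    have h2 := (hX' (k + 1)).neg
    have e : φ (Matrix.of X) - Matrix.of X =
        (φ (Matrix.of X) - φ (s k)) + -(Matrix.of X - s (k + 1)) := by rw [hs]; abel
    rw [e]
    have hqk : 0 ≤ q ^ k := by positivity
    have hqq : q * q ≤ 1 := by nlinarith
    refine (h1.mono ?_).add (h2.mono ?_)
    · nlinarith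
    · rw [pow_succ]; nlinarith
  rw [← sub_eq_zero]
  ext i j
  apply S.inj
  funext l
  rw [Matrix.zero_apply, map_zero, Pi.zero_apply, ← norm_le_zero_iff]
  exact ge_of_tendsto' (tendsto_pow_atTop_nhds_zero_of_lt_one hq0 hq1) fun k => hb k i j l

theorem exists_posM (S : ESetup coeff) : ∃ P : Matrix m m E → Matrix m m E,
    ∀ X i j k, coeff (P X i j) k = if 0 < k then coeff (X i j) k else 0 := by
  classical
  choose f hf using S.exists_trunc (Set.Ioi 0)
  exact ⟨fun X => X.map f, fun X i j k => by
    refine (hf (X i j) k).trans ?_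
    by_cases h : 0 < k <;> simp [h]⟩

theorem pos_mul (S : ESetup coeff) {x y : E} (hx : ∀ i ≤ 0, coeff x i = 0)
    (hy : ∀ i ≤ 0, coeff y i = 0) : ∀ i ≤ 0, coeff (x * y) i = 0 := by
  intro n hn
  have h := S.mul x y n
  have : (fun i : ℤ => coeff x i * coeff y (n - i)) = fun _ => 0 := by
    funext i
    by_cases hi : i ≤ 0
    · rw [hx i hi, zero_mul]
    · rw [hy (n - i) (by omega), mul_zero]
  rw [this] at h
  exact h.unique hasSum_zero

def LauM (S : ESetup coeff) (X : Matrix m m E) : Prop := ∀ i j, X i j ∈ S.lauRing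

theorem lauM_mul (S : ESetup coeff) {X Y : Matrix m m E} (hX : S.LauM X) (hY : S.LauM Y) :
    S.LauM (X * Y) := fun i j => by
  rw [Matrix.mul_apply]
  exact Subring.sum_mem _ fun l _ => Subring.mul_mem _ (hX i l) (hY l j)

theorem lauM_one (S : ESetup coeff) : S.LauM (1 : Matrix m m E) := fun i j => by
  rw [Matrix.one_apply]
  split_ifs
  · exact Subring.one_mem _
  · exact Subring.zero_mem _

theorem lauM_add (S : ESetup coeff) {X Y : Matrix m m E} (hX : S.LauM X) (hY : S.LauM Y) :
    S.LauM (X + Y) := fun i j => Subring.add_mem _ (hX i j) (hY i j)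

theorem birkhoff (S : ESetup coeff) {q : ℝ} (hq0 : 0 ≤ q) (hq1 : q < 1) (M : Matrix m m E)
    (hM : BdM coeff M q) : ∃ U V : Matrix m m E, U * V = 1 ∧ S.LauM U ∧ S.LauM V ∧
      ∀ i j k, 0 < k → coeff ((U * (1 + M)) i j) k = 0 := by
  obtain ⟨P, hP⟩ := S.exists_posM (m := m)
  have hPb : ∀ X c, 0 ≤ c → BdM coeff X c → BdM coeff (P X) c := fun X c hc hX i j k => by
    rw [hP]; split_ifs
    · exact hX i j k
    · simpa using hc
  have hPs : ∀ X Y, P X - P Y = P (X - Y) := fun X Y => by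
    ext i j
    apply S.inj
    funext k
    rw [Matrix.sub_apply, map_sub, Pi.sub_apply, hP, hP, hP, Matrix.sub_apply, map_sub, Pi.sub_apply]
    split_ifs <;> simp
  have hneg : ∀ A B : Matrix m m E, -P A - -P B = -P (A - B) := fun A B => by
    rw [← hPs]; abel
  obtain ⟨X, hX, hXq⟩ := S.fixpt hq0 hq1 (fun X => -P (M + X * M)) (fun X Y c hc h => by
    simp only [hneg]
    have e : M + X * M - (M + Y * M) = (X - Y) * M := by rw [sub_mul]; abel
    rw [e, mul_comm q c]
    exact (hPb _ _ (by positivity) (S.bdM_mul hc hq0 h hM)).neg) (by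
    simp only [zero_mul, add_zero]
    exact (hPb _ _ hq0 hM).neg)
  obtain ⟨Y, hY, -⟩ := S.fixpt hq0 hq1 (fun Y => -P (X + X * Y)) (fun Y Z c hc h => by
    simp only [hneg]
    have e : X + X * Y - (X + X * Z) = X * (Y - Z) := by rw [mul_sub]; abel
    rw [e]
    exact (hPb _ _ (by positivity) (S.bdM_mul hq0 hc hXq h)).neg) (by
    simp only [mul_zero, add_zero]
    exact (hPb _ _ hq0 hXq).neg)
  have hXp : ∀ i j, ∀ k ≤ 0, coeff (X i j) k = 0 := fun i j k hk => by
    rw [← hX, Matrix.neg_apply, map_neg, Pi.neg_apply, hP, if_neg (by omega), neg_zero]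
  have hYp : ∀ i j, ∀ k ≤ 0, coeff (Y i j) k = 0 := fun i j k hk => by
    rw [← hY, Matrix.neg_apply, map_neg, Pi.neg_apply, hP, if_neg (by omega), neg_zero]
  have hXYp : ∀ i j, ∀ k ≤ 0, coeff ((X * Y) i j) k = 0 := fun i j k hk => by
    rw [Matrix.mul_apply, map_sum, Finset.sum_apply]
    exact Finset.sum_eq_zero fun l _ => S.pos_mul (hXp i l) (hYp l j) k hk
  have hPid : P (X + X * Y) = X + X * Y := by
    ext i j
    apply S.inj
    funext k
    rw [hP]
    split_ifs with h
    · rfl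
    · rw [Matrix.add_apply, map_add, Pi.add_apply, hXp i j k (by omega), hXYp i j k (by omega),
        add_zero]
  rw [hPid] at hY
  have hlX : S.LauM X := fun i j => ⟨0, fun k hk => hXp i j k hk.le⟩
  have hlY : S.LauM Y := fun i j => ⟨0, fun k hk => hYp i j k hk.le⟩
  refine ⟨1 + X, 1 + Y, ?_, S.lauM_add S.lauM_one hlX, S.lauM_add S.lauM_one hlY, ?_⟩
  · have : (1 + X) * (1 + Y) = 1 + (Y + (X + X * Y)) := by noncomm_ring
    rw [this]
    nth_rewrite 1 [← hY]
    simp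
  · intro i j k hk
    have e : (1 + X) * (1 + M) = 1 + (X + (M + X * M)) := by noncomm_ring
    have h1 : coeff ((1 : Matrix m m E) i j) k = 0 := by
      rw [Matrix.one_apply]
      split_ifs
      · rw [S.one]; simp; omega
      · simp
    have h2 : coeff (X i j) k = - coeff ((M + X * M) i j) k := by
      nth_rewrite 1 [← hX]
      rw [Matrix.neg_apply, map_neg, Pi.neg_apply, hP, if_pos hk]
    rw [e, Matrix.add_apply, Matrix.add_apply, map_add, map_add, Pi.add_apply, Pi.add_apply, h1, h2]
    simp

/-- approximable by invertible Laurent matrices -/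
def W (S : ESetup coeff) (A : Matrix m m E) : Prop :=
  ∃ h h' : Matrix m m E, h * h' = 1 ∧ S.LauM h ∧ S.LauM h' ∧
    ∃ q : ℝ, 0 ≤ q ∧ q < 1 ∧ BdM coeff (h' * A - 1) q

theorem lauM_diag (S : ESetup coeff) (d : m → E) (hd : ∀ i, Lau coeff (d i)) :
    S.LauM (Matrix.diagonal d) := fun i j => by
  rw [Matrix.diagonal_apply]
  split_ifs
  · exact hd i
  · exact Subring.zero_mem _

theorem W_diag (S : ESetup coeff) (d : m → E) (hd : ∀ i, d i ≠ 0) : S.W (Matrix.diagonal d) := by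
  choose r hr0 hr hr' q hq0 hq1 hq using fun i => S.unit_approx (hd i)
  obtain ⟨Q, hQ⟩ : ∃ Q : ℝ, (∀ i, q i ≤ Q) ∧ 0 ≤ Q ∧ Q < 1 := by
    have h1 : ∀ᶠ Q : ℝ in nhdsWithin 1 (Set.Iio 1), ∀ i, q i ≤ Q :=
      eventually_all.mpr fun i => nhdsWithin_le_nhds (le_mem_nhds (hq1 i))
    have h2 : ∀ᶠ r : ℝ in nhdsWithin 1 (Set.Iio 1), r < 1 := eventually_mem_nhdsWithin
    have h3 : ∀ᶠ r : ℝ in nhdsWithin 1 (Set.Iio 1), 0 ≤ r :=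
      nhdsWithin_le_nhds (le_mem_nhds one_pos)
    exact (h1.and (h3.and h2)).exists
  refine ⟨Matrix.diagonal r, Matrix.diagonal fun i => (r i)⁻¹, ?_, S.lauM_diag _ hr,
    S.lauM_diag _ hr', Q, hQ.2.1, hQ.2.2, ?_⟩
  · rw [Matrix.diagonal_mul_diagonal, ← Matrix.diagonal_one]
    congr 1; funext i; exact mul_inv_cancel₀ (hr0 i)
  · rw [Matrix.diagonal_mul_diagonal, ← Matrix.diagonal_one, Matrix.diagonal_sub]
    intro i j k
    rw [Matrix.diagonal_apply]
    split_ifs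
    · exact (hq i k).trans (hQ.1 i)
    · simpa using hQ.2.1

theorem lauM_transvec (S : ESetup coeff) (i j : m) {c : E} (hc : Lau coeff c) :
    S.LauM (Matrix.transvection i j c) := S.lauM_add S.lauM_one fun a b => by
  rw [Matrix.single_apply]
  split_ifs
  · exact hc
  · exact Subring.zero_mem _

theorem W_transvec (S : ESetup coeff) {A : Matrix m m E} (hA : S.W A) {i j : m} (hij : i ≠ j)
    (c : E) : S.W (Matrix.transvection i j c * A) := by
  classical
  obtain ⟨h, h', hh, hl, hl', q, hq0, hq1, hq⟩ := hA
  obtain ⟨C, hC0, hC⟩ := S.bdM_exists h'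
  obtain ⟨D, hD0, hD⟩ := S.bdM_exists A
  set ε : ℝ := 1 / (2 * (C * D + 1)) with hε
  have hε0 : 0 < ε := by positivity
  obtain ⟨N, hN⟩ := S.lim c ε hε0
  obtain ⟨c', hc'⟩ := S.exists_trunc (Set.Ioi N) c
  have hcl : Lau coeff c' := ⟨N, fun i hi => by rw [hc', if_neg]; simpa using hi.le⟩
  have hcd : ∀ k, ‖coeff (c - c') k‖ ≤ ε := fun k => by
    rw [map_sub, Pi.sub_apply, hc']
    by_cases hk : N < k
    · simp [hk, hε0.le]
    · simpa [hk] using hN k (not_lt.mp hk)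
  refine ⟨Matrix.transvection i j c' * h, h' * Matrix.transvection i j (-c'), ?_,
    S.lauM_mul (S.lauM_transvec i j hcl) hl,
    S.lauM_mul hl' (S.lauM_transvec i j (S.lauRing.neg_mem hcl)), max q (1 / 2),
    hq0.trans (le_max_left _ _), max_lt hq1 (by norm_num), ?_⟩
  · rw [mul_assoc, ← mul_assoc h, hh, one_mul, Matrix.transvection_mul_transvection_same _ _ hij]
    simp
  · have e : h' * Matrix.transvection i j (-c') * (Matrix.transvection i j c * A) - 1 =
        (h' * A - 1) + h' * Matrix.single i j (c - c') * A := by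
      rw [mul_assoc, ← mul_assoc (Matrix.transvection i j (-c')),
        Matrix.transvection_mul_transvection_same _ _ hij, neg_add_eq_sub, Matrix.transvection]
      noncomm_ring
    rw [e]
    refine (hq.mono (le_max_left _ _)).add ?_
    have hs : BdM coeff (Matrix.single i j (c - c')) ε := fun a b k => by
      rw [Matrix.single_apply]
      split_ifs
      · exact hcd k
      · simpa using hε0.le
    refine (S.bdM_mul (by positivity) hD0 (S.bdM_mul hC0 hε0.le hC hs) hD).mono
      (le_trans ?_ (le_max_right _ _))
    rw [hε]
    have : 0 ≤ C * D := by positivity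
    rw [show C * (1 / (2 * (C * D + 1))) * D = (C * D) / (2 * (C * D + 1)) by ring,
      div_le_div_iff₀ (by positivity) (by norm_num)]
    linarith

theorem diag_transvec (d : m → E) (hd : ∀ i, d i ≠ 0) (i j : m) (c : E) :
    Matrix.diagonal d * Matrix.transvection i j c =
      Matrix.transvection i j (d i * c * (d j)⁻¹) * Matrix.diagonal d := by
  rw [Matrix.transvection, Matrix.transvection, mul_add, add_mul, mul_one, one_mul]
  congr 1
  ext a b
  rw [Matrix.diagonal_mul, Matrix.mul_diagonal, Matrix.single_apply, Matrix.single_apply]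
  split_ifs with h
  · obtain ⟨rfl, rfl⟩ := h
    field_simp [hd j]
  · simp

theorem W_all (S : ESetup coeff) (A : Matrix m m E) (hA : A.det ≠ 0) : S.W A := by
  obtain ⟨L1, L2, D, rfl⟩ :=
    Matrix.Pivot.exists_list_transvec_mul_diagonal_mul_list_transvec A
  have hD : ∀ i, D i ≠ 0 := by
    rw [Matrix.det_mul, Matrix.det_mul, Matrix.det_diagonal] at hA
    have := right_ne_zero_of_mul (left_ne_zero_of_mul hA)
    intro i
    exact Finset.prod_ne_zero_iff.mp this i (Finset.mem_univ i)
  have h2 : S.W (Matrix.diagonal D * (L2.map Matrix.TransvectionStruct.toMatrix).prod) := by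
    clear hA
    induction L2 with
    | nil => simpa using S.W_diag D hD
    | cons t l ih =>
      rw [List.map_cons, List.prod_cons, ← mul_assoc, Matrix.TransvectionStruct.toMatrix,
        diag_transvec D hD, mul_assoc]
      exact S.W_transvec ih t.hij _
  rw [mul_assoc]
  clear hA
  induction L1 with
  | nil => simpa using h2
  | cons t l ih =>
    rw [List.map_cons, List.prod_cons, mul_assoc]
    exact S.W_transvec ih t.hij _

theorem main (S : ESetup coeff) (A : Matrix m m E) (hA : A.det ≠ 0) :
    ∃ B B' : Matrix m m E, B * B' = 1 ∧ S.LauM B ∧ S.LauM B' ∧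
      ∀ i j k, 0 < k → coeff ((B * A) i j) k = 0 := by
  obtain ⟨h, h', hh, hl, hl', q, hq0, hq1, hq⟩ := S.W_all A hA
  obtain ⟨U, V, hUV, hU, hV, hk⟩ := S.birkhoff hq0 hq1 _ hq
  refine ⟨U * h', h * V, ?_, S.lauM_mul hU hl', S.lauM_mul hl hV, ?_⟩
  · rw [mul_assoc, ← mul_assoc h', mul_eq_one_comm.mp hh, one_mul, hUV]
  · rw [mul_assoc]
    simpa using hk

end ESetup

theorem vp_le_iff {p : ℕ} (hp : p.Prime) {K : Type*} [NormedField K] {x : K} (hx : x ≠ 0) (M : ℝ) :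
    M ≤ vp p x ↔ ‖x‖ ≤ (p : ℝ) ^ (-M) := by
  have h1 : (1 : ℝ) < p := by exact_mod_cast hp.one_lt
  rw [vp, le_neg, Real.logb_le_iff_le_rpow h1 (norm_pos_iff.mpr hx)]

/-- For every `n ≥ 1` and every `L ∈ GL_n(𝓔)` there exists
`B ∈ GL_n(𝒪_K[[T]][T⁻¹][1/p])` (i.e. `B` and `B⁻¹` have entries in that
subring of `𝓔`) such that every entry of `B·L` lies in the image of
`K⟨T,T⁻¹⟩` in `𝓔`.  Here the field `𝓔` is presented through the bijection
`coeff` sending an element to its coefficient sequence `(aᵢ)` (with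
`Σ aᵢ Tⁱ` in `𝓔`), which is additive and turns multiplication into
convolution. -/
theorem statement12 {K E : Type*} [NontriviallyNormedField K] [CompleteSpace K]
    [IsUltrametricDist K] {p : ℕ} (hp : p.Prime)
    (hpnorm : ‖(p : K)‖ = (p : ℝ)⁻¹)
    [Field E] (coeff : E →+ (ℤ → K))
    (hinj : Function.Injective coeff)
    (hone : coeff 1 = fun i : ℤ => if i = 0 then 1 else 0)
    (hmulc : ∀ x y : E, ∀ n : ℤ,
      HasSum (fun i : ℤ => coeff x i * coeff y (n - i)) (coeff (x * y) n))
    (hmem : ∀ x : E, MemE p (coeff x))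
    (hsurj : ∀ a : ℤ → K, MemE p a → ∃ x : E, coeff x = a)
    (n : ℕ) (hn : 1 ≤ n) (L : Matrix.GeneralLinearGroup (Fin n) E) :
    ∃ B : Matrix.GeneralLinearGroup (Fin n) E,
      (∀ i j : Fin n,
        IsLaurentElem coeff ((B : Matrix (Fin n) (Fin n) E) i j) ∧
        IsLaurentElem coeff (((B⁻¹ : Matrix.GeneralLinearGroup (Fin n) E) :
          Matrix (Fin n) (Fin n) E) i j)) ∧
      ∀ i j : Fin n,
        IsTateElem coeff (((B * L : Matrix.GeneralLinearGroup (Fin n) E) :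
          Matrix (Fin n) (Fin n) E) i j) := by
  have h1 : (1 : ℝ) < p := by exact_mod_cast hp.one_lt
  have h0 : (0 : ℝ) < p := by linarith
  have S : ESetup coeff := by
    refine ⟨hinj, hone, hmulc, fun x => ?_, fun x ε hε => ?_, fun a ⟨C, hC⟩ ha => hsurj a ⟨?_, ?_⟩⟩
    · obtain ⟨B, hB⟩ := (hmem x).1
      refine ⟨(p : ℝ) ^ (-B), fun i => ?_⟩
      by_cases h : coeff x i = 0
      · rw [h, norm_zero]; positivity
      · exact (vp_le_iff hp h B).mp (hB i h)
    · obtain ⟨N, hN⟩ := (hmem x).2 (-Real.logb p ε)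
      refine ⟨N, fun i hi => ?_⟩
      by_cases h : coeff x i = 0
      · rw [h, norm_zero]; exact hε.le
      · have := (vp_le_iff hp h _).mp (hN i hi h)
        rwa [neg_neg, Real.rpow_logb h0 h1.ne' hε] at this
    · refine ⟨-Real.logb p (|C| + 1), fun i hi => ?_⟩
      rw [vp_le_iff hp hi, neg_neg, Real.rpow_logb h0 h1.ne' (by positivity)]
      linarith [hC i, le_abs_self C]
    · intro M
      obtain ⟨N, hN⟩ := ha ((p : ℝ) ^ (-M)) (by positivity)
      exact ⟨N, fun i hi h => (vp_le_iff hp h M).mpr (hN i hi)⟩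
  obtain ⟨B, B', hBB, hB, hB', hk⟩ := S.main (L : Matrix (Fin n) (Fin n) E)
    ((Matrix.isUnit_iff_isUnit_det _).mp L.isUnit).ne_zero
  refine ⟨⟨B, B', hBB, mul_eq_one_comm.mp hBB⟩, fun i j => ⟨⟨hB i j, S.bdd _⟩, ⟨hB' i j, S.bdd _⟩⟩,
    fun i j => ⟨S.bdd _, ?_, ?_⟩⟩
  · refine tendsto_const_nhds.congr' ?_
    filter_upwards [eventually_gt_atTop 0] with k hk0
    exact (norm_eq_zero.mpr (hk i j k hk0)).symm
  · rw [Metric.tendsto_nhds]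
    intro ε hε
    obtain ⟨N, hN⟩ := S.lim ((B * (L : Matrix (Fin n) (Fin n) E)) i j) (ε / 2) (by linarith)
    filter_upwards [eventually_le_atBot N] with k hk0
    rw [Real.dist_eq, sub_zero, abs_norm]
    exact (hN k hk0).trans_lt (by linarith)
end
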